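/- For every integer j ≥ 334 and every positive integer m, the number m + j is the sum of exactly j positive eighth powers if and only if m + 334 is the sum of exactly 334 positive eighth powers. -/

import Mathlib

/-- A positive integer `n` is `(j,k)`-representable if it is a sum of exactly `j`
positive `k`-th powers. -/
def IsRepr (n j k : ℕ) : Prop :=
  ∃ a : Fin j → ℕ, (∀ i, 0 < a i) ∧ ∑ i, (a i) ^ k = n

namespace EighthPowers

open Finset

/-- The additive character `x ↦ exp (2πix)` of the reals. -/
noncomputable def expo (x : ℝ) : ℂ := Complex.exp ((2 * Real.pi * x : ℝ) * Complex.I)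

theorem expo_add (x y : ℝ) : expo (x + y) = expo x * expo y := by
  simp only [expo, ← Complex.exp_add]
  push_cast
  ring_nf

@[simp] theorem expo_zero : expo 0 = 1 := by simp [expo]

@[simp] theorem norm_expo (x : ℝ) : ‖expo x‖ = 1 := Complex.norm_exp_ofReal_mul_I _

theorem expo_intCast (n : ℤ) : expo n = 1 := by
  rw [expo, Complex.exp_eq_one_iff]
  exact ⟨n, by push_cast; ring⟩

theorem expo_add_intCast (x : ℝ) (n : ℤ) : expo (x + n) = expo x := by
  rw [expo_add, expo_intCast, mul_one]

theorem expo_eq_one_iff {x : ℝ} : expo x = 1 ↔ ∃ n : ℤ, x = n := by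
  refine ⟨fun h => ?_, fun ⟨n, hn⟩ => hn ▸ expo_intCast n⟩
  rw [expo, Complex.exp_eq_one_iff] at h
  obtain ⟨n, hn⟩ := h
  refine ⟨n, ?_⟩
  have h2 : ((2 * Real.pi * x : ℝ) : ℂ) = ((2 * Real.pi * n : ℝ) : ℂ) := by
    apply mul_right_cancel₀ Complex.I_ne_zero
    rw [hn]; push_cast; ring
  have h3 := Complex.ofReal_injective h2
  exact mul_left_cancel₀ (by positivity) h3

theorem expo_nat_mul (n : ℕ) (x : ℝ) : expo (n * x) = expo x ^ n := by
  induction n with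
  | zero => simp
  | succ n ih => rw [pow_succ, ← ih, ← expo_add]; congr 1; push_cast; ring

theorem conj_expo (x : ℝ) : (starRingEnd ℂ) (expo x) = expo (-x) := by
  rw [expo, expo, ← Complex.exp_conj, map_mul, Complex.conj_ofReal, Complex.conj_I]
  push_cast
  ring_nf

theorem norm_expo_sub_one (x : ℝ) : ‖expo x - 1‖ = 2 * |Real.sin (Real.pi * x)| := by
  rw [expo, mul_comm, Complex.norm_exp_I_mul_ofReal_sub_one, norm_mul, Real.norm_eq_abs,
    Real.norm_eq_abs, abs_of_pos (by norm_num : (0 : ℝ) < 2)]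
  congr 3
  ring

theorem norm_expo_sub_one_le (x : ℝ) : ‖expo x - 1‖ ≤ 2 * Real.pi * |x| := by
  rw [norm_expo_sub_one]
  have := Real.abs_sin_le_abs (x := Real.pi * x)
  rw [abs_mul, abs_of_pos Real.pi_pos] at this
  linarith

theorem norm_expo_sub_expo_le (x y : ℝ) : ‖expo x - expo y‖ ≤ 2 * Real.pi * |x - y| := by
  have : expo x - expo y = expo y * (expo (x - y) - 1) := by
    rw [mul_sub, ← expo_add]; simp
  rw [this, norm_mul, norm_expo, one_mul]
  exact norm_expo_sub_one_le _

theorem le_norm_expo_sub_one {x : ℝ} (h0 : 0 ≤ x) (h : x ≤ 1 / 2) : 4 * x ≤ ‖expo x - 1‖ := by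
  rw [norm_expo_sub_one]
  have hp := Real.pi_pos
  have h1 : 2 / Real.pi * (Real.pi * x) ≤ Real.sin (Real.pi * x) :=
    Real.mul_le_sin (by positivity) (by nlinarith)
  have h2 : 2 / Real.pi * (Real.pi * x) = 2 * x := by field_simp
  have := le_abs_self (Real.sin (Real.pi * x))
  linarith

theorem sum_expo_mul_div {d : ℕ} (hd : 0 < d) (k : ℤ) :
    ∑ a ∈ range d, expo (a * (k / d)) = if (d : ℤ) ∣ k then (d : ℂ) else 0 := by
  have hd' : (d : ℝ) ≠ 0 := by positivity
  simp only [expo_nat_mul]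
  split_ifs with h
  · obtain ⟨m, rfl⟩ := h
    have : expo (((d * m : ℤ) : ℝ) / d) = 1 := by
      rw [expo_eq_one_iff]; exact ⟨m, by push_cast; field_simp⟩
    rw [this]
    simp
  · have h1 : expo ((k : ℝ) / d) ≠ 1 := by
      rw [Ne, expo_eq_one_iff]
      rintro ⟨n, hn⟩
      apply h
      refine ⟨n, ?_⟩
      rw [div_eq_iff hd'] at hn
      have : (k : ℝ) = ((d * n : ℤ) : ℝ) := by rw [hn]; push_cast; ring
      exact_mod_cast this
    rw [geom_sum_eq h1, ← expo_nat_mul]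
    have : expo (d * ((k : ℝ) / d)) = 1 := by
      rw [expo_eq_one_iff]; exact ⟨k, by field_simp⟩
    simp [this]

/-- Parseval's identity modulo `d` for frequencies that are distinct modulo `d`. -/
theorem sum_norm_sq_sum_expo {ι : Type*} {d : ℕ} (hd : 0 < d) (s : Finset ι) (k : ι → ℤ)
    (c : ι → ℂ) (hk : ∀ x ∈ s, ∀ y ∈ s, (d : ℤ) ∣ k x - k y → x = y) :
    ∑ u ∈ range d, ‖∑ x ∈ s, c x * expo (u * (k x / d))‖ ^ 2 = d * ∑ x ∈ s, ‖c x‖ ^ 2 := by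
  classical
  have key : ∀ u : ℕ, ((‖∑ x ∈ s, c x * expo (u * (k x / d))‖ ^ 2 : ℝ) : ℂ) =
      ∑ x ∈ s, ∑ y ∈ s, c x * (starRingEnd ℂ) (c y) *
        expo (u * (((k x - k y : ℤ) : ℝ) / d)) := by
    intro u
    rw [Complex.ofReal_pow, ← Complex.mul_conj', map_sum, sum_mul_sum]
    refine sum_congr rfl fun x _ => sum_congr rfl fun y _ => ?_
    rw [map_mul, conj_expo, mul_mul_mul_comm, ← expo_add]
    congr 2
    push_cast
    ring
  have : ((∑ u ∈ range d, ‖∑ x ∈ s, c x * expo (u * (k x / d))‖ ^ 2 : ℝ) : ℂ) =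
      ((d * ∑ x ∈ s, ‖c x‖ ^ 2 : ℝ) : ℂ) := by
    rw [Complex.ofReal_sum]
    simp_rw [key]
    rw [sum_comm, Complex.ofReal_mul, Complex.ofReal_natCast, Complex.ofReal_sum, mul_sum]
    refine sum_congr rfl fun x hx => ?_
    rw [sum_comm]
    simp_rw [← mul_sum]
    rw [sum_eq_single_of_mem x hx]
    · have := sum_expo_mul_div hd (k x - k x)
      simp only [sub_self, dvd_zero, if_true] at this
      rw [sub_self, this, Complex.mul_conj', Complex.ofReal_pow]
      ring
    · intro y hy hne
      rw [sum_expo_mul_div hd, if_neg, mul_zero]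
      exact fun h => hne (hk x hx y hy h).symm
  exact_mod_cast this

/-- If the nontrivial Fourier coefficients of a finite family modulo `q` are small on average,
then the family meets every residue class. -/
theorem exists_modEq_of_sum_norm_lt {ι : Type*} {q : ℕ} (hq : 0 < q) (s : Finset ι) (f : ι → ℕ)
    (h : ∑ a ∈ Ico 1 q, ‖∑ x ∈ s, expo (a * ((f x : ℝ) / q))‖ < #s) (r : ℕ) :
    ∃ x ∈ s, f x ≡ r [MOD q] := by
  by_contra! hcon
  have h0 : ∑ a ∈ range q, ∑ x ∈ s, expo (a * (((f x : ℤ) - r : ℤ) / q)) = 0 := by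
    rw [sum_comm]
    refine sum_eq_zero fun x hx => ?_
    rw [sum_expo_mul_div hq, if_neg]
    intro hdvd
    exact hcon x hx ((Nat.modEq_iff_dvd.mpr hdvd).symm)
  rw [range_eq_Ico, sum_eq_sum_Ico_succ_bot hq] at h0
  have h1 : ∀ a : ℕ, ∑ x ∈ s, expo (a * (((f x : ℤ) - r : ℤ) / q)) =
      (∑ x ∈ s, expo (a * ((f x : ℝ) / q))) * expo (-(a * ((r : ℝ) / q))) := by
    intro a
    rw [sum_mul]
    refine sum_congr rfl fun x _ => ?_
    rw [← expo_add]
    congr 1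
    push_cast
    ring
  have h2 : (#s : ℂ) = -∑ a ∈ Ico 1 q, ∑ x ∈ s, expo (a * (((f x : ℤ) - r : ℤ) / q)) := by
    rw [eq_neg_iff_add_eq_zero]
    simpa using h0
  have h3 : (#s : ℝ) ≤ ∑ a ∈ Ico 1 q, ‖∑ x ∈ s, expo (a * ((f x : ℝ) / q))‖ := by
    calc (#s : ℝ) = ‖(#s : ℂ)‖ := by simp
      _ ≤ _ := by
        rw [h2, norm_neg]
        refine (norm_sum_le _ _).trans (le_of_eq (sum_congr rfl fun a _ => ?_))
        rw [h1, norm_mul, norm_expo, mul_one]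
  linarith

/-- Abel summation against a sequence of bounded partial sums. -/
theorem norm_sum_mul_le_of_partial_sums {c w : ℕ → ℂ} {M : ℝ} {n : ℕ}
    (hM : ∀ m ≤ n, ‖∑ i ∈ range m, c i‖ ≤ M) :
    ‖∑ i ∈ range n, w i * c i‖ ≤
      M * (‖w (n - 1)‖ + ∑ i ∈ range (n - 1), ‖w (i + 1) - w i‖) := by
  have h := sum_range_by_parts w c n
  simp only [smul_eq_mul] at h
  rw [h, mul_add]
  refine (norm_sub_le _ _).trans (add_le_add ?_ ?_)
  · rw [norm_mul, mul_comm]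
    exact mul_le_mul_of_nonneg_right (hM n le_rfl) (norm_nonneg _)
  · rw [mul_sum]
    refine (norm_sum_le _ _).trans (sum_le_sum fun i hi => ?_)
    rw [norm_mul, mul_comm]
    refine mul_le_mul_of_nonneg_right (hM _ ?_) (norm_nonneg _)
    have := mem_range.mp hi
    omega

/-- The Kusmin–Landau inequality. -/
theorem norm_sum_expo_le_of_monotone_diff {f : ℕ → ℝ} {l : ℝ} (hl : 0 < l)
    (hmono : Monotone fun i => f (i + 1) - f i) (n : ℕ)
    (hlow : ∀ i, l ≤ f (i + 1) - f i) (hhigh : ∀ i < n, f (i + 1) - f i ≤ 1 / 2) :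
    ‖∑ i ∈ range n, expo (f i)‖ ≤ 2 / l := by
  rcases Nat.eq_zero_or_pos n with rfl | hn
  · simp only [range_zero, sum_empty, norm_zero]; positivity
  set δ : ℕ → ℝ := fun i => f (i + 1) - f i with hδ
  have hpos : ∀ i, 0 < δ i := fun i => hl.trans_le (hlow i)
  have hlower : ∀ i < n, 4 * δ i ≤ ‖expo (δ i) - 1‖ := fun i hi =>
    le_norm_expo_sub_one (hpos i).le (hhigh i hi)
  have hne : ∀ i < n, expo (δ i) - 1 ≠ 0 := fun i hi h0 => by
    have := hlower i hi
    rw [h0, norm_zero] at this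
    linarith [hpos i]
  have hsum : ∑ i ∈ range n, expo (f i) =
      ∑ i ∈ range n, (expo (δ i) - 1)⁻¹ * (expo (f (i + 1)) - expo (f i)) := by
    refine sum_congr rfl fun i hi => ?_
    have h1 : expo (f (i + 1)) = expo (f i) * expo (δ i) := by
      rw [← expo_add]; congr 1; simp [hδ]
    rw [h1, eq_inv_mul_iff_mul_eq₀ (hne i (mem_range.mp hi))]
    ring
  rw [hsum]
  have hpart : ∀ m ≤ n, ‖∑ i ∈ range m, (expo (f (i + 1)) - expo (f i))‖ ≤ 2 := by
    intro m _
    rw [sum_range_sub (fun i => expo (f i))]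
    refine (norm_sub_le _ _).trans ?_
    simp only [norm_expo]
    norm_num
  refine (norm_sum_mul_le_of_partial_sums hpart).trans ?_
  have h1 : ‖(expo (δ (n - 1)) - 1)⁻¹‖ ≤ 1 / (4 * l) := by
    rw [norm_inv, inv_eq_one_div]
    refine one_div_le_one_div_of_le (by positivity) ?_
    have := hlower (n - 1) (by omega)
    have := hlow (n - 1)
    simp only [hδ] at *
    linarith
  have h2 : ∀ i ∈ range (n - 1), ‖(expo (δ (i + 1)) - 1)⁻¹ - (expo (δ i) - 1)⁻¹‖ ≤
      Real.pi / 8 * (1 / δ i - 1 / δ (i + 1)) := by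
    intro i hi
    have hi' := mem_range.mp hi
    have ha := hlower i (by omega)
    have hb := hlower (i + 1) (by omega)
    have hm : δ i ≤ δ (i + 1) := hmono (Nat.le_succ i)
    have pa := hpos i
    have pb := hpos (i + 1)
    rw [inv_sub_inv (hne _ (by omega)) (hne _ (by omega)), norm_div, norm_mul]
    have hnum : ‖expo (δ i) - 1 - (expo (δ (i + 1)) - 1)‖ ≤
        2 * Real.pi * (δ (i + 1) - δ i) := by
      have := norm_expo_sub_expo_le (δ i) (δ (i + 1))
      rw [abs_sub_comm, abs_of_nonneg (sub_nonneg.mpr hm)] at this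
      simpa using this
    calc _ ≤ 2 * Real.pi * (δ (i + 1) - δ i) / ((4 * δ (i + 1)) * (4 * δ i)) := by
          gcongr
      _ = _ := by field_simp; ring
  have h3 : ∑ i ∈ range (n - 1), ‖(expo (δ (i + 1)) - 1)⁻¹ - (expo (δ i) - 1)⁻¹‖ ≤
      Real.pi / 8 * (1 / l) := by
    refine (sum_le_sum h2).trans ?_
    rw [← mul_sum]
    refine mul_le_mul_of_nonneg_left ?_ (by positivity)
    rw [sum_range_sub' (fun i => 1 / δ i)]
    have := one_div_le_one_div_of_le hl (hlow 0)
    have h5 : 0 < 1 / δ (n - 1) := by have := hpos (n - 1); positivity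
    simp only [hδ] at *
    linarith
  have hpi : Real.pi < 4 := Real.pi_lt_four
  have h4 : (1 / (4 * l) : ℝ) = 1 / 4 * (1 / l) := by field_simp
  have h6 : (2 / l : ℝ) = 2 * (1 / l) := by ring
  have h7 : 0 < 1 / l := by positivity
  nlinarith

theorem norm_sum_expo_mul_pow_le_of_pos {β : ℝ} (hβ : 0 < β) {X : ℕ} (hX : 0 < X)
    (h : 8 * β * (2 * X) ^ 7 ≤ 1 / 2) :
    ‖∑ i ∈ range X, expo (β * ((X + i : ℕ) : ℝ) ^ 8)‖ ≤ 1 / (4 * β * X ^ 7) := by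
  have hX' : (0 : ℝ) < X := by exact_mod_cast hX
  have hf : ∀ y : ℝ, (y + 1) ^ 8 - y ^ 8 =
      8 * y ^ 7 + 28 * y ^ 6 + 56 * y ^ 5 + 70 * y ^ 4 + 56 * y ^ 3 + 28 * y ^ 2 + 8 * y + 1 := by
    intro y; ring
  have hd : ∀ i : ℕ, β * ((X + (i + 1) : ℕ) : ℝ) ^ 8 - β * ((X + i : ℕ) : ℝ) ^ 8 =
      β * ((((X + i : ℕ) : ℝ) + 1) ^ 8 - ((X + i : ℕ) : ℝ) ^ 8) := by
    intro i; push_cast; ring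
  have key := norm_sum_expo_le_of_monotone_diff (f := fun i : ℕ => β * ((X + i : ℕ) : ℝ) ^ 8)
    (l := 8 * β * X ^ 7) (by positivity) ?_ X ?_ ?_
  · refine key.trans (le_of_eq ?_)
    field_simp
    norm_num
  · intro i j hij
    simp only [hd, hf]
    gcongr
  · intro i
    simp only [hd, hf]
    have h1 : (X : ℝ) ^ 7 ≤ ((X + i : ℕ) : ℝ) ^ 7 := by gcongr; simp
    have h2 : (0 : ℝ) ≤ ((X + i : ℕ) : ℝ) := by positivity
    have h3 : (8 : ℝ) * X ^ 7 ≤ 8 * ((X + i : ℕ) : ℝ) ^ 7 + 28 * ((X + i : ℕ) : ℝ) ^ 6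
        + 56 * ((X + i : ℕ) : ℝ) ^ 5 + 70 * ((X + i : ℕ) : ℝ) ^ 4 + 56 * ((X + i : ℕ) : ℝ) ^ 3
        + 28 * ((X + i : ℕ) : ℝ) ^ 2 + 8 * ((X + i : ℕ) : ℝ) + 1 := by
      have : (0 : ℝ) ≤ 28 * ((X + i : ℕ) : ℝ) ^ 6
        + 56 * ((X + i : ℕ) : ℝ) ^ 5 + 70 * ((X + i : ℕ) : ℝ) ^ 4 + 56 * ((X + i : ℕ) : ℝ) ^ 3
        + 28 * ((X + i : ℕ) : ℝ) ^ 2 + 8 * ((X + i : ℕ) : ℝ) + 1 := by positivity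
      linarith
    nlinarith
  · intro i hi
    simp only [hd]
    refine le_trans ?_ h
    have hz : ((X + i : ℕ) : ℝ) + 1 ≤ 2 * X := by
      have : X + i + 1 ≤ 2 * X := by omega
      exact_mod_cast this
    have hy : (0 : ℝ) ≤ ((X + i : ℕ) : ℝ) := by positivity
    generalize ((X + i : ℕ) : ℝ) = y at hz hy
    have : (y + 1) ^ 8 - y ^ 8 ≤ 8 * (y + 1) ^ 7 := by
      have : 8 * (y + 1) ^ 7 - ((y + 1) ^ 8 - y ^ 8) =
        28 * y ^ 6 + 112 * y ^ 5 + 210 * y ^ 4 + 224 * y ^ 3 + 140 * y ^ 2 + 48 * y + 7 := by ring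
      have : 0 ≤ 28 * y ^ 6 + 112 * y ^ 5 + 210 * y ^ 4 + 224 * y ^ 3 + 140 * y ^ 2 + 48 * y + 7 := by
        positivity
      linarith
    have h2 : (y + 1) ^ 7 ≤ (2 * (X : ℝ)) ^ 7 := by gcongr
    nlinarith

theorem norm_sum_expo_mul_pow_le {β : ℝ} (hβ : β ≠ 0) {X : ℕ} (hX : 0 < X)
    (h : 8 * |β| * (2 * X) ^ 7 ≤ 1 / 2) :
    ‖∑ i ∈ range X, expo (β * ((X + i : ℕ) : ℝ) ^ 8)‖ ≤ 1 / (4 * |β| * X ^ 7) := by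
  rcases lt_or_gt_of_ne hβ with hneg | hpos
  · have := norm_sum_expo_mul_pow_le_of_pos (abs_pos.mpr hβ) hX h
    rw [← Complex.norm_conj, map_sum] at this
    simp only [conj_expo, abs_of_neg hneg, neg_mul, neg_neg] at this ⊢
    exact this
  · have := norm_sum_expo_mul_pow_le_of_pos (abs_pos.mpr hβ) hX h
    rwa [abs_of_pos hpos] at this ⊢

theorem sum_range_add_of_periodic {M : Type*} [AddCommGroup M] {d : ℕ} {h : ℕ → M}
    (hper : ∀ i, h (i + d) = h i) (X : ℕ) :
    ∑ i ∈ range d, h (X + i) = ∑ i ∈ range d, h i := by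
  induction X with
  | zero => simp
  | succ X ih =>
    rw [← ih]
    have h1 := sum_range_succ (fun i => h (X + i)) d
    rw [sum_range_succ', hper X] at h1
    simp only [add_zero, add_left_inj] at h1
    rw [← h1]
    exact sum_congr rfl fun i _ => by congr 1; ring

theorem norm_sum_range_le_of_periodic {d : ℕ} (hd : 0 < d) {g : ℕ → ℂ} {K : ℝ}
    (hper : ∀ i, g (i + d) = g i) (hsum : ∑ i ∈ range d, g i = 0) (hK : ∀ i, ‖g i‖ ≤ K) (m : ℕ) :
    ‖∑ i ∈ range m, g i‖ ≤ d * K := by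
  have hK0 : 0 ≤ K := (norm_nonneg _).trans (hK 0)
  induction m using Nat.strong_induction_on with
  | _ m ih =>
    rcases lt_or_ge m d with hlt | hge
    · refine (norm_sum_le _ _).trans ((sum_le_card_nsmul _ _ K fun i _ => hK i).trans ?_)
      rw [card_range, nsmul_eq_mul]
      gcongr
    · obtain ⟨k, rfl⟩ := Nat.exists_eq_add_of_le hge
      rw [sum_range_add, hsum, zero_add]
      simpa only [add_comm d, hper] using ih k (by omega)

/-- Approximation of an eighth-power sum on a major arc. -/
theorem norm_sum_expo_major_le {d X : ℕ} (hd : 0 < d) (hX : 0 < X) (b : ℤ) {β G : ℝ}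
    (hβ : β ≠ 0) (hsmall : 8 * |β| * (2 * X) ^ 7 ≤ 1 / 2)
    (hG : ‖∑ x ∈ range d, expo (b * (x : ℝ) ^ 8 / d)‖ ≤ G * d) :
    ‖∑ i ∈ range X, expo ((b / d + β) * ((X + i : ℕ) : ℝ) ^ 8)‖ ≤
      G * min (X : ℝ) (1 / (4 * |β| * X ^ 7)) +
        2 * d * (1 + 2 * Real.pi * (|β| * (2 * X) ^ 8)) := by
  have hd' : (0 : ℝ) < d := by exact_mod_cast hd
  have hG0 : 0 ≤ G := by
    by_contra hneg
    have := (norm_nonneg _).trans hG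
    nlinarith
  set S := ∑ x ∈ range d, expo (b * (x : ℝ) ^ 8 / d) with hS
  set h : ℕ → ℂ := fun i => expo (b * (i : ℝ) ^ 8 / d) with hh
  set w : ℕ → ℂ := fun i => expo (β * ((X + i : ℕ) : ℝ) ^ 8) with hw
  have hper : ∀ i, h (i + d) = h i := by
    intro i
    simp only [hh]
    obtain ⟨k, hk⟩ : (d : ℤ) ∣ b * ((i + d : ℕ) : ℤ) ^ 8 - b * (i : ℤ) ^ 8 := by
      rw [← mul_sub]
      refine Dvd.dvd.mul_left ?_ _
      refine dvd_trans ?_ (sub_dvd_pow_sub_pow _ _ 8)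
      simp
    have hk' : (b : ℝ) * ((i + d : ℕ) : ℝ) ^ 8 = b * (i : ℝ) ^ 8 + d * k := by
      have : b * ((i + d : ℕ) : ℤ) ^ 8 = b * (i : ℤ) ^ 8 + d * k := by linarith
      exact_mod_cast this
    rw [hk', add_div, mul_div_cancel_left₀ _ hd'.ne', expo_add_intCast]
  have hShift : ∑ i ∈ range d, h (X + i) = S := sum_range_add_of_periodic hper X
  set g : ℕ → ℂ := fun i => h (X + i) - S / d with hg
  have hS1 : ‖S‖ ≤ d := by
    refine (norm_sum_le _ _).trans ?_
    simp
  have hgsum : ∑ i ∈ range d, g i = 0 := by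
    simp only [hg, sum_sub_distrib, hShift, sum_const, card_range, nsmul_eq_mul]
    rw [mul_div_cancel₀ _ (Nat.cast_ne_zero.mpr hd.ne'), sub_self]
  have hgnorm : ∀ i, ‖g i‖ ≤ 2 := by
    intro i
    refine (norm_sub_le _ _).trans ?_
    rw [norm_div, Complex.norm_natCast]
    have : ‖S‖ / d ≤ 1 := (div_le_one hd').mpr hS1
    simp only [hh, norm_expo]
    linarith
  have hgpart : ∀ m ≤ X, ‖∑ i ∈ range m, g i‖ ≤ d * 2 := fun m _ =>
    norm_sum_range_le_of_periodic hd (fun i => by simp only [hg, ← add_assoc, hper]) hgsum hgnorm m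
  have hsplit : ∑ i ∈ range X, expo ((b / d + β) * ((X + i : ℕ) : ℝ) ^ 8) =
      S / d * ∑ i ∈ range X, w i + ∑ i ∈ range X, w i * g i := by
    rw [mul_sum, ← sum_add_distrib]
    refine sum_congr rfl fun i _ => ?_
    have : expo ((b / d + β) * ((X + i : ℕ) : ℝ) ^ 8) = w i * h (X + i) := by
      rw [← expo_add]; congr 1; ring
    rw [this]
    simp only [hg]
    ring
  have hvar : ∑ i ∈ range (X - 1), ‖w (i + 1) - w i‖ ≤ 2 * Real.pi * (|β| * (2 * X) ^ 8) := by
    have h1 : ∀ i ∈ range (X - 1), ‖w (i + 1) - w i‖ ≤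
        2 * Real.pi * |β| * (((X + (i + 1) : ℕ) : ℝ) ^ 8 - ((X + i : ℕ) : ℝ) ^ 8) := by
      intro i _
      refine (norm_expo_sub_expo_le _ _).trans (le_of_eq ?_)
      have : ((X + i : ℕ) : ℝ) ^ 8 ≤ ((X + (i + 1) : ℕ) : ℝ) ^ 8 := by
        gcongr; omega
      rw [← mul_sub, abs_mul, abs_of_nonneg (sub_nonneg.mpr this)]
      ring
    refine (sum_le_sum h1).trans ?_
    rw [← mul_sum, sum_range_sub (fun i => ((X + i : ℕ) : ℝ) ^ 8), mul_assoc (2 * Real.pi)]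
    have : ((X + (X - 1) : ℕ) : ℝ) ^ 8 ≤ (2 * X) ^ 8 := by
      gcongr
      have : X + (X - 1) ≤ 2 * X := by omega
      exact_mod_cast this
    have h0 : (0 : ℝ) ≤ ((X + 0 : ℕ) : ℝ) ^ 8 := by positivity
    gcongr
    linarith
  have herr : ‖∑ i ∈ range X, w i * g i‖ ≤ 2 * d * (1 + 2 * Real.pi * (|β| * (2 * X) ^ 8)) := by
    refine (norm_sum_mul_le_of_partial_sums hgpart).trans ?_
    rw [mul_comm (d : ℝ) 2]
    have : ‖w (X - 1)‖ = 1 := norm_expo _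
    rw [this]
    gcongr
  have hmain : ‖∑ i ∈ range X, w i‖ ≤ min (X : ℝ) (1 / (4 * |β| * X ^ 7)) := by
    refine le_min ?_ (norm_sum_expo_mul_pow_le hβ hX hsmall)
    refine (norm_sum_le _ _).trans ?_
    simp [hw]
  rw [hsplit]
  refine (norm_add_le _ _).trans (add_le_add ?_ herr)
  rw [norm_mul, norm_div, Complex.norm_natCast]
  have : ‖S‖ / d ≤ G := (div_le_iff₀ hd').mpr hG
  gcongr

/-- The number of pairs of residues modulo `d` with equal eighth powers. -/
noncomputable def eighthPairs (d : ℕ) : ℕ :=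
  Nat.card {z : ZMod d × ZMod d // z.1 ^ 8 = z.2 ^ 8}

/-- The number of eighth roots of unity modulo `d`. -/
noncomputable def eighthRoots (d : ℕ) : ℕ :=
  Nat.card {u : (ZMod d)ˣ // u ^ 8 = 1}

theorem sum_norm_sq_sum_stdAddChar (d : ℕ) [NeZero d] :
    ∑ c : ZMod d, ‖∑ x : ZMod d, ZMod.stdAddChar (c * x ^ 8)‖ ^ 2 = (d : ℝ) * eighthPairs d := by
  have h : ∀ c : ZMod d, ((‖∑ x : ZMod d, ZMod.stdAddChar (c * x ^ 8)‖ ^ 2 : ℝ) : ℂ) =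
      ∑ z : ZMod d × ZMod d, ZMod.stdAddChar (c * (z.1 ^ 8 - z.2 ^ 8)) := by
    intro c
    push_cast
    rw [← Complex.mul_conj', map_sum, sum_mul_sum, ← univ_product_univ, sum_product]
    refine sum_congr rfl fun x _ => sum_congr rfl fun y _ => ?_
    rw [← AddChar.map_neg_eq_conj, ← AddChar.map_add_eq_mul]
    congr 1
    ring
  have hcard : (eighthPairs d : ℂ) =
      ∑ z : ZMod d × ZMod d, if z.1 ^ 8 - z.2 ^ 8 = 0 then (1 : ℂ) else 0 := by
    rw [sum_boole, eighthPairs, Nat.card_eq_fintype_card, Fintype.card_subtype]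
    simp only [sub_eq_zero]
  have hc : ((∑ c : ZMod d, ‖∑ x : ZMod d, ZMod.stdAddChar (c * x ^ 8)‖ ^ 2 : ℝ) : ℂ) =
      (((d : ℝ) * eighthPairs d : ℝ) : ℂ) := by
    rw [Complex.ofReal_sum, sum_congr rfl fun c _ => h c, sum_comm]
    push_cast
    rw [hcard, mul_sum]
    refine sum_congr rfl fun z _ => ?_
    rw [AddChar.sum_mulShift _ (ZMod.isPrimitive_stdAddChar d), ZMod.card]
    simp
  exact_mod_cast hc

theorem norm_sum_stdAddChar_sq_mul_totient_le (d : ℕ) [NeZero d] (b : (ZMod d)ˣ) :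
    ‖∑ x : ZMod d, ZMod.stdAddChar ((b : ZMod d) * x ^ 8)‖ ^ 2 * d.totient ≤
      (eighthRoots d : ℝ) * (d * eighthPairs d) := by
  set F : ZMod d → ℝ := fun c => ‖∑ x : ZMod d, ZMod.stdAddChar (c * x ^ 8)‖ ^ 2 with hF
  have hinv : ∀ u : (ZMod d)ˣ, F ((b * u ^ 8 : (ZMod d)ˣ) : ZMod d) = F b := by
    intro u
    simp only [hF]
    congr 2
    refine Fintype.sum_equiv (Units.mulLeft u) _ _ fun x => ?_
    simp [mul_pow, mul_assoc]
  have hfib : ∀ c : (ZMod d)ˣ, #{u : (ZMod d)ˣ | b * u ^ 8 = c} ≤ eighthRoots d := by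
    intro c
    rw [eighthRoots, Nat.card_eq_fintype_card, Fintype.card_subtype]
    rcases ({u : (ZMod d)ˣ | b * u ^ 8 = c} : Finset (ZMod d)ˣ).eq_empty_or_nonempty with h0 | ⟨v, hv⟩
    · simp [h0]
    · refine card_le_card_of_injOn (fun u => u * v⁻¹) (fun u hu => ?_)
        (fun x _ y _ hxy => mul_right_cancel hxy)
      simp only [coe_filter, mem_filter, mem_univ, true_and, Set.mem_ofPred_eq] at hu hv ⊢
      rw [mul_pow, inv_pow, mul_inv_eq_one]
      exact mul_left_cancel (hu.trans hv.symm)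
  calc F b * d.totient = ∑ u : (ZMod d)ˣ, F ((b * u ^ 8 : (ZMod d)ˣ) : ZMod d) := by
        rw [sum_congr rfl fun u _ => hinv u]
        simp [ZMod.card_units_eq_totient, mul_comm]
    _ = ∑ c : (ZMod d)ˣ, ∑ u : (ZMod d)ˣ with b * u ^ 8 = c, F (c : ZMod d) := by
        rw [← sum_fiberwise univ (fun u : (ZMod d)ˣ => b * u ^ 8)]
        refine sum_congr rfl fun c _ => sum_congr rfl fun u hu => ?_
        rw [(mem_filter.mp hu).2]
    _ ≤ ∑ c : (ZMod d)ˣ, eighthRoots d * F (c : ZMod d) := by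
        refine sum_le_sum fun c _ => ?_
        rw [sum_const, nsmul_eq_mul]
        exact mul_le_mul_of_nonneg_right (by exact_mod_cast hfib c) (sq_nonneg _)
    _ ≤ eighthRoots d * ∑ c : ZMod d, F c := by
        rw [← mul_sum]
        gcongr
        rw [← sum_image (f := F) (s := univ) (g := fun c : (ZMod d)ˣ => (c : ZMod d))
          (fun x _ y _ h => Units.ext h)]
        exact sum_le_sum_of_subset_of_nonneg (subset_univ _) fun c _ _ => by positivity
    _ = _ := by rw [sum_norm_sq_sum_stdAddChar]

theorem eighthPairs_mul {m n : ℕ} (h : m.Coprime n) :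
    eighthPairs (m * n) = eighthPairs m * eighthPairs n := by
  rw [eighthPairs, eighthPairs, eighthPairs, ← Nat.card_prod]
  let e := ZMod.chineseRemainder h
  refine Nat.card_congr
    { toFun := fun z => (⟨((e z.1.1).1, (e z.1.2).1), ?_⟩, ⟨((e z.1.1).2, (e z.1.2).2), ?_⟩)
      invFun := fun w => ⟨(e.symm (w.1.1.1, w.2.1.1), e.symm (w.1.1.2, w.2.1.2)), ?_⟩
      left_inv := fun z => by simp
      right_inv := fun w => by simp }
  · have := congrArg (fun t => (e t).1) z.2
    simpa using this
  · have := congrArg (fun t => (e t).2) z.2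
    simpa using this
  · simp only [← map_pow]
    congr 1
    exact Prod.ext w.1.2 w.2.2

theorem eighthRoots_mul {m n : ℕ} (h : m.Coprime n) :
    eighthRoots (m * n) = eighthRoots m * eighthRoots n := by
  rw [eighthRoots, eighthRoots, eighthRoots, ← Nat.card_prod]
  let e := (Units.mapEquiv (ZMod.chineseRemainder h).toMulEquiv).trans MulEquiv.prodUnits
  refine Nat.card_congr
    { toFun := fun z => (⟨(e z.1).1, ?_⟩, ⟨(e z.1).2, ?_⟩)
      invFun := fun w => ⟨e.symm (w.1.1, w.2.1), ?_⟩
      left_inv := fun z => by simp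
      right_inv := fun w => by simp }
  · have := congrArg (fun t => (e t).1) z.2
    simpa using this
  · have := congrArg (fun t => (e t).2) z.2
    simpa using this
  · rw [← map_pow, map_eq_one_iff e.symm e.symm.injective]
    exact Prod.ext w.1.2 w.2.2

theorem card_pow_eight_eq_one_le_of_orderOf {G : Type*} [CommGroup G] [Fintype G] [DecidableEq G]
    (g : G) (hg : Nat.card G ≤ orderOf g * 2) : #{u : G | u ^ 8 = 1} ≤ 16 := by
  classical
  set H := Subgroup.zpowers g with hH
  have hindex : H.index ≤ 2 := by
    have h1 := H.card_mul_index
    rw [hH, Nat.card_zpowers, ← hH] at h1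
    have h2 : 0 < orderOf g := orderOf_pos g
    nlinarith
  have hfib : ∀ c ∈ ({u : G | u ^ 8 = 1} : Finset G).image (QuotientGroup.mk (s := H)),
      #{u ∈ ({u : G | u ^ 8 = 1} : Finset G) | QuotientGroup.mk (s := H) u = c} ≤ 8 := by
    intro c hc
    obtain ⟨v, hv, rfl⟩ := mem_image.mp hc
    have hv8 := (mem_filter.mp hv).2
    refine le_trans ?_ (IsCyclic.card_pow_eq_one_le (α := H) (n := 8) (by norm_num))
    refine card_le_card_of_injOn
      (fun u => if hu : v⁻¹ * u ∈ H then (⟨v⁻¹ * u, hu⟩ : H) else 1) (fun u hu => ?_)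
      (fun x hx y hy hxy => ?_)
    · simp only [coe_filter, mem_filter, mem_univ, true_and, Set.mem_ofPred_eq] at hu ⊢
      have hu' : v⁻¹ * u ∈ H := QuotientGroup.eq.mp hu.2.symm
      rw [dif_pos hu']
      ext
      simp [mul_pow, hu.1, hv8]
    · simp only [coe_filter, mem_filter, mem_univ, true_and, Set.mem_ofPred_eq] at hx hy
      have hx' : v⁻¹ * x ∈ H := QuotientGroup.eq.mp hx.2.symm
      have hy' : v⁻¹ * y ∈ H := QuotientGroup.eq.mp hy.2.symm
      simp only [dif_pos hx', dif_pos hy', Subtype.mk.injEq] at hxy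
      exact mul_left_cancel hxy
  refine (card_le_mul_card_image _ 8 hfib).trans ?_
  have : #(({u : G | u ^ 8 = 1} : Finset G).image (QuotientGroup.mk (s := H))) ≤ H.index := by
    rw [Subgroup.index_eq_card, Nat.card_eq_fintype_card]
    exact card_le_univ _
  omega

theorem eighthRoots_eq_card (d : ℕ) [NeZero d] :
    eighthRoots d = #{u : (ZMod d)ˣ | u ^ 8 = 1} := by
  rw [eighthRoots, Nat.card_eq_fintype_card, Fintype.card_subtype]

theorem eighthRoots_prime_pow_le {p : ℕ} (hp : p.Prime) (hp2 : p ≠ 2) (l : ℕ) :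
    eighthRoots (p ^ l) ≤ 8 := by
  have : NeZero (p ^ l) := ⟨pow_ne_zero _ hp.ne_zero⟩
  have := ZMod.isCyclic_units_of_prime_pow p hp hp2 l
  rw [eighthRoots_eq_card]
  exact IsCyclic.card_pow_eq_one_le (by norm_num)

theorem eighthRoots_two_pow_le (l : ℕ) : eighthRoots (2 ^ l) ≤ 16 := by
  rw [eighthRoots_eq_card]
  obtain hl | ⟨n, rfl⟩ : l < 2 ∨ ∃ n, l = n + 2 := by
    rcases lt_or_ge l 2 with h | h
    · exact .inl h
    · exact .inr ⟨l - 2, by omega⟩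
  · refine (card_le_univ _).trans ?_
    rw [ZMod.card_units_eq_totient]
    refine (Nat.totient_le _).trans ?_
    interval_cases l <;> norm_num
  · have h5 : IsUnit (5 : ZMod (2 ^ (n + 2))) := by
      have := (ZMod.isUnit_iff_coprime 5 (2 ^ (n + 2))).mpr (Nat.Coprime.pow_right _ (by norm_num))
      simpa using this
    obtain ⟨g, hg⟩ := h5
    refine card_pow_eight_eq_one_le_of_orderOf g ?_
    rw [← orderOf_units, hg, ZMod.orderOf_five, Nat.card_eq_fintype_card,
      ZMod.card_units_eq_totient, Nat.totient_prime_pow Nat.prime_two (by omega)]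
    simp [pow_succ]

theorem eighthPairs_eq_card (d : ℕ) [NeZero d] :
    eighthPairs d = #{z ∈ range d ×ˢ range d | z.1 ^ 8 ≡ z.2 ^ 8 [MOD d]} := by
  rw [eighthPairs, Nat.card_eq_fintype_card, Fintype.card_subtype]
  refine card_nbij' (fun z => (z.1.val, z.2.val)) (fun z => ((z.1 : ZMod d), (z.2 : ZMod d)))
    (fun z hz => ?_) (fun z hz => ?_) (fun z _ => by simp) (fun z hz => ?_)
  · simp only [coe_filter, mem_univ, true_and, Set.mem_ofPred_eq, mem_product, mem_range] at hz ⊢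
    refine ⟨⟨ZMod.val_lt _, ZMod.val_lt _⟩, ?_⟩
    rw [← ZMod.natCast_eq_natCast_iff]
    simpa using hz
  · simp only [coe_filter, mem_univ, true_and, Set.mem_ofPred_eq, mem_product, mem_range] at hz ⊢
    have := (ZMod.natCast_eq_natCast_iff _ _ _).mpr hz.2
    simpa using this
  · simp only [coe_filter, Set.mem_ofPred_eq, mem_product, mem_range] at hz
    simp [ZMod.val_natCast, Nat.mod_eq_of_lt hz.1.1, Nat.mod_eq_of_lt hz.1.2]

/-- Pairs with an invertible entry. -/
theorem card_unit_pairs_le {p l : ℕ} (hp : p.Prime) :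
    #{z ∈ range (p ^ l) ×ˢ range (p ^ l) | z.1 ^ 8 ≡ z.2 ^ 8 [MOD p ^ l] ∧ ¬ p ∣ z.2} ≤
      eighthRoots (p ^ l) * p ^ l := by
  classical
  have : NeZero (p ^ l) := ⟨pow_ne_zero _ hp.ne_zero⟩
  have hfib : ∀ y ∈ ({z ∈ range (p ^ l) ×ˢ range (p ^ l) |
      z.1 ^ 8 ≡ z.2 ^ 8 [MOD p ^ l] ∧ ¬ p ∣ z.2} : Finset (ℕ × ℕ)).image Prod.snd,
      #{z ∈ ({z ∈ range (p ^ l) ×ˢ range (p ^ l) |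
      z.1 ^ 8 ≡ z.2 ^ 8 [MOD p ^ l] ∧ ¬ p ∣ z.2} : Finset (ℕ × ℕ)) | z.2 = y} ≤
        eighthRoots (p ^ l) := by
    intro y hy
    obtain ⟨⟨x₀, y'⟩, h0, rfl⟩ := mem_image.mp hy
    simp only [mem_filter, mem_product, mem_range] at h0
    have hyc : y'.Coprime (p ^ l) := (((Nat.Prime.coprime_iff_not_dvd hp).mpr h0.2.2).pow_left l).symm
    set v := ZMod.unitOfCoprime y' hyc with hv
    have hunit : ∀ x : ℕ, x ^ 8 ≡ y' ^ 8 [MOD p ^ l] → x.Coprime (p ^ l) := by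
      intro x hx
      have h1 : (x ^ 8).gcd (p ^ l) = (y' ^ 8).gcd (p ^ l) := hx.gcd_eq
      have h2 : (x ^ 8).Coprime (p ^ l) := h1.trans (hyc.pow_left 8)
      exact (Nat.coprime_pow_left_iff (by norm_num) _ _).mp h2
    rw [eighthRoots_eq_card]
    refine card_le_card_of_injOn
      (fun z => if h : z.1.Coprime (p ^ l) then ZMod.unitOfCoprime z.1 h * v⁻¹ else 1)
      (fun z hz => ?_) (fun z hz w hw hzw => ?_)
    · simp only [coe_filter, mem_filter, mem_product, mem_range, Set.mem_ofPred_eq, mem_univ,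
        true_and] at hz ⊢
      obtain ⟨⟨_, hz1, _⟩, hz2⟩ := hz
      rw [hz2] at hz1
      rw [dif_pos (hunit _ hz1), mul_pow, inv_pow, mul_inv_eq_one]
      ext
      have := (ZMod.natCast_eq_natCast_iff _ _ _).mpr hz1
      simpa [hv] using this
    · simp only [coe_filter, mem_filter, mem_product, mem_range, Set.mem_ofPred_eq] at hz hw
      obtain ⟨⟨hzr, hz1, _⟩, hz2⟩ := hz
      obtain ⟨⟨hwr, hw1, _⟩, hw2⟩ := hw
      rw [hz2] at hz1
      rw [hw2] at hw1
      simp only [dif_pos (hunit _ hz1), dif_pos (hunit _ hw1)] at hzw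
      have h1 := congrArg Units.val (mul_right_cancel hzw)
      simp only [ZMod.coe_unitOfCoprime] at h1
      have h2 := (ZMod.natCast_eq_natCast_iff _ _ _).mp h1
      exact Prod.ext (h2.eq_of_lt_of_lt hzr.1 hwr.1) (hz2.trans hw2.symm)
  refine (card_le_mul_card_image _ _ hfib).trans ?_
  gcongr
  calc _ ≤ #(range (p ^ l)) := card_le_card fun y hy => by
        obtain ⟨z, hz, rfl⟩ := mem_image.mp hy
        exact (mem_product.mp (mem_filter.mp hz).1).2
    _ = _ := card_range _

theorem eighthPairs_prime_pow_le_add {p l : ℕ} (hp : p.Prime) (hl : 0 < l) :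
    eighthPairs (p ^ l) ≤ eighthRoots (p ^ l) * p ^ l +
      #{z ∈ range (p ^ (l - 1)) ×ˢ range (p ^ (l - 1)) |
        (p * z.1) ^ 8 ≡ (p * z.2) ^ 8 [MOD p ^ l]} := by
  classical
  have : NeZero (p ^ l) := ⟨pow_ne_zero _ hp.ne_zero⟩
  rw [eighthPairs_eq_card, ← card_filter_add_card_filter_not (fun z : ℕ × ℕ => ¬ p ∣ z.2),
    filter_filter, filter_filter]
  refine add_le_add (card_unit_pairs_le hp) ?_
  have hpl : p ^ l = p * p ^ (l - 1) := by
    rw [← pow_succ']; congr 1; omega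
  refine card_le_card_of_injOn (fun z => (z.1 / p, z.2 / p)) (fun z hz => ?_)
    (fun z hz w hw hzw => ?_)
  all_goals
    have hdiv : ∀ z : ℕ × ℕ, z.1 ^ 8 ≡ z.2 ^ 8 [MOD p ^ l] → p ∣ z.2 → p ∣ z.1 := by
      intro z h1 h2
      have h3 : z.1 ^ 8 ≡ z.2 ^ 8 [MOD p] := h1.of_dvd (dvd_pow_self p hl.ne')
      exact hp.dvd_of_dvd_pow ((h3.dvd_iff dvd_rfl).mpr (dvd_pow h2 (by norm_num)))
    simp only [coe_filter, mem_product, mem_range, Set.mem_ofPred_eq, not_not] at *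
  · obtain ⟨⟨hz1, hz2⟩, hz3, hz4⟩ := hz
    rw [Nat.mul_div_cancel' hz4, Nat.mul_div_cancel' (hdiv z hz3 hz4)]
    rw [hpl] at hz1 hz2
    exact ⟨⟨Nat.div_lt_of_lt_mul hz1, Nat.div_lt_of_lt_mul hz2⟩, hz3⟩
  · obtain ⟨_, hz3, hz4⟩ := hz
    obtain ⟨_, hw3, hw4⟩ := hw
    have h1 := congrArg (fun t => p * t.1) hzw
    have h2 := congrArg (fun t => p * t.2) hzw
    simp only [Nat.mul_div_cancel' hz4, Nat.mul_div_cancel' hw4,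
      Nat.mul_div_cancel' (hdiv z hz3 hz4), Nat.mul_div_cancel' (hdiv w hw3 hw4)] at h1 h2
    exact Prod.ext h1 h2

theorem eighthPairs_prime_pow_le {p l : ℕ} (hp : p.Prime) (hl : 0 < l) :
    eighthPairs (p ^ l) ≤ eighthRoots (p ^ l) * p ^ l + p ^ (2 * (l - 1)) := by
  refine (eighthPairs_prime_pow_le_add hp hl).trans (Nat.add_le_add_left ?_ _)
  refine (card_filter_le _ _).trans (le_of_eq ?_)
  rw [card_product, card_range, two_mul, pow_add]

theorem eighthPairs_prime_pow_add_le {p l : ℕ} (hp : p.Prime) :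
    eighthPairs (p ^ (l + 8)) ≤ eighthRoots (p ^ (l + 8)) * p ^ (l + 8) +
      p ^ 14 * eighthPairs (p ^ l) := by
  have : NeZero (p ^ l) := ⟨pow_ne_zero _ hp.ne_zero⟩
  refine (eighthPairs_prime_pow_le_add hp (by omega)).trans (Nat.add_le_add_left ?_ _)
  rw [eighthPairs_eq_card]
  have hcard : p ^ 14 * #{z ∈ range (p ^ l) ×ˢ range (p ^ l) | z.1 ^ 8 ≡ z.2 ^ 8 [MOD p ^ l]} =
      #((range (p ^ 7) ×ˢ range (p ^ 7)) ×ˢ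
        ({z ∈ range (p ^ l) ×ˢ range (p ^ l) | z.1 ^ 8 ≡ z.2 ^ 8 [MOD p ^ l]} : Finset (ℕ × ℕ))) := by
    rw [card_product, card_product, card_range]
    ring
  rw [hcard]
  have hP : 0 < p ^ l := pow_pos hp.pos _
  refine card_le_card_of_injOn
    (fun z => ((z.1 / p ^ l, z.2 / p ^ l), (z.1 % p ^ l, z.2 % p ^ l))) (fun z hz => ?_)
    (fun z hz w hw hzw => ?_)
  · simp only [coe_filter, mem_product, mem_range, Set.mem_ofPred_eq, coe_product, Set.mem_prod,
      SetLike.mem_coe] at hz ⊢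
    have e1 : p ^ (l + 8 - 1) = p ^ l * p ^ 7 := by rw [← pow_add]; congr 1
    rw [e1] at hz
    refine ⟨⟨Nat.div_lt_of_lt_mul hz.1.1, Nat.div_lt_of_lt_mul hz.1.2⟩,
      ⟨Nat.mod_lt _ hP, Nat.mod_lt _ hP⟩, ?_⟩
    have h1 := hz.2
    rw [mul_pow, mul_pow, add_comm l 8, pow_add] at h1
    have h2 : z.1 ^ 8 ≡ z.2 ^ 8 [MOD p ^ l] :=
      Nat.ModEq.mul_left_cancel' (pow_ne_zero _ hp.ne_zero) h1
    exact ((Nat.mod_modEq _ _).pow 8).trans (h2.trans ((Nat.mod_modEq _ _).pow 8).symm)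
  · simp only [Prod.mk.injEq] at hzw
    refine Prod.ext ?_ ?_
    · rw [← Nat.div_add_mod z.1 (p ^ l), hzw.1.1, hzw.2.1, Nat.div_add_mod]
    · rw [← Nat.div_add_mod z.2 (p ^ l), hzw.1.2, hzw.2.2, Nat.div_add_mod]

/-- Growth of the number of pairs along the powers of a prime `p = w ^ 5`. -/
theorem eighthPairs_prime_pow_le_mul {p : ℕ} (hp : p.Prime) {w c R : ℝ} (hw : w ^ 5 = p)
    (hw1 : 1 ≤ w) (hR : ∀ l, (eighthRoots (p ^ l) : ℝ) ≤ R)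
    (h1 : R * (w ^ 4)⁻¹ + (w ^ 2)⁻¹ ≤ c) (h2 : R * (w ^ 36)⁻¹ + c * (w ^ 2)⁻¹ ≤ c)
    {l : ℕ} (hl : 0 < l) : (eighthPairs (p ^ l) : ℝ) ≤ c * w ^ (9 * l) := by
  have hw0 : 0 < w := by linarith
  have hR0 : 0 ≤ R := (Nat.cast_nonneg _).trans (hR 0)
  induction l using Nat.strong_induction_on with
  | _ l ih =>
    rcases le_or_gt l 8 with h8 | h8
    · have h : (eighthPairs (p ^ l) : ℝ) ≤ eighthRoots (p ^ l) * p ^ l + p ^ (2 * (l - 1)) := by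
        exact_mod_cast eighthPairs_prime_pow_le hp hl
      rw [← hw, ← pow_mul, ← pow_mul] at h
      have e1 : w ^ (5 * l) ≤ (w ^ 4)⁻¹ * w ^ (9 * l) := by
        rw [le_inv_mul_iff₀ (by positivity), ← pow_add]
        exact pow_le_pow_right₀ hw1 (by omega)
      have e2 : w ^ (5 * (2 * (l - 1))) ≤ (w ^ 2)⁻¹ * w ^ (9 * l) := by
        rw [le_inv_mul_iff₀ (by positivity), ← pow_add]
        exact pow_le_pow_right₀ hw1 (by omega)
      calc _ ≤ R * w ^ (5 * l) + w ^ (5 * (2 * (l - 1))) := h.trans (by gcongr; exact hR l)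
        _ ≤ R * ((w ^ 4)⁻¹ * w ^ (9 * l)) + (w ^ 2)⁻¹ * w ^ (9 * l) := by gcongr
        _ = (R * (w ^ 4)⁻¹ + (w ^ 2)⁻¹) * w ^ (9 * l) := by ring
        _ ≤ _ := by gcongr
    · obtain ⟨k, rfl⟩ : ∃ k, l = k + 8 := ⟨l - 8, by omega⟩
      have h : (eighthPairs (p ^ (k + 8)) : ℝ) ≤
          eighthRoots (p ^ (k + 8)) * p ^ (k + 8) + p ^ 14 * eighthPairs (p ^ k) := by
        exact_mod_cast eighthPairs_prime_pow_add_le hp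
      rw [← hw, ← pow_mul, ← pow_mul] at h
      have e1 : w ^ (5 * (k + 8)) ≤ (w ^ 36)⁻¹ * w ^ (9 * (k + 8)) := by
        rw [le_inv_mul_iff₀ (by positivity), ← pow_add]
        exact pow_le_pow_right₀ hw1 (by omega)
      have e2 : w ^ (5 * 14) * w ^ (9 * k) = (w ^ 2)⁻¹ * w ^ (9 * (k + 8)) := by
        rw [eq_inv_mul_iff_mul_eq₀ (by positivity)]
        ring
      calc _ ≤ R * w ^ (5 * (k + 8)) + w ^ (5 * 14) * (c * w ^ (9 * k)) :=
            h.trans (by gcongr; exacts [hR _, ih k (by omega) (by omega)])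
        _ = R * w ^ (5 * (k + 8)) + c * (w ^ (5 * 14) * w ^ (9 * k)) := by ring
        _ ≤ R * ((w ^ 36)⁻¹ * w ^ (9 * (k + 8))) + c * ((w ^ 2)⁻¹ * w ^ (9 * (k + 8))) := by
            rw [e2]; gcongr
        _ = (R * (w ^ 36)⁻¹ + c * (w ^ 2)⁻¹) * w ^ (9 * (k + 8)) := by ring
        _ ≤ _ := by gcongr

/-- An upper bound for `d⁻² ‖S‖²`, where `S` is a complete eighth-power sum modulo `d`. -/
noncomputable def completeSumBound (d : ℕ) : ℝ :=
  eighthRoots d * eighthPairs d / (d * d.totient)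

theorem completeSumBound_nonneg (d : ℕ) : 0 ≤ completeSumBound d := by
  unfold completeSumBound; positivity

theorem completeSumBound_mul {m n : ℕ} (h : m.Coprime n) :
    completeSumBound (m * n) = completeSumBound m * completeSumBound n := by
  simp only [completeSumBound, eighthRoots_mul h, eighthPairs_mul h, Nat.totient_mul h]
  push_cast
  rw [div_mul_div_comm]
  congr 1 <;> ring

theorem completeSumBound_prime_pow_le {p : ℕ} (hp : p.Prime) {w c R : ℝ} (hw : w ^ 5 = p)
    (hw1 : 1 ≤ w) (hR : ∀ l, (eighthRoots (p ^ l) : ℝ) ≤ R)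
    (h1 : R * (w ^ 4)⁻¹ + (w ^ 2)⁻¹ ≤ c) (h2 : R * (w ^ 36)⁻¹ + c * (w ^ 2)⁻¹ ≤ c)
    {l : ℕ} (hl : 0 < l) {D : ℝ} (hD : R * c * p ≤ D * (p - 1)) :
    completeSumBound (p ^ l) ^ 5 * (p ^ l : ℕ) ≤ D ^ 5 := by
  have hw0 : 0 < w := by linarith
  have hp0 : (0 : ℝ) < p := by exact_mod_cast hp.pos
  have hp1 : (0 : ℝ) < p - 1 := by
    have : (2 : ℝ) ≤ p := by exact_mod_cast hp.two_le
    linarith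
  have hR0 : 0 ≤ R := (Nat.cast_nonneg _).trans (hR 0)
  have hE := eighthPairs_prime_pow_le_mul hp hw hw1 hR h1 h2 hl
  have hc : 0 ≤ c := le_trans (by positivity) h1
  have hφ : ((p ^ l).totient : ℝ) * p = p ^ l * (p - 1) := by
    obtain ⟨k, rfl⟩ : ∃ k, l = k + 1 := ⟨l - 1, by omega⟩
    rw [Nat.totient_prime_pow hp hl, Nat.cast_mul, Nat.cast_sub hp.one_lt.le]
    simp [pow_succ]
    ring
  have hD0 : 0 ≤ D := by
    by_contra hneg
    have : 0 ≤ R * c * p := by positivity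
    nlinarith
  have key : completeSumBound (p ^ l) * w ^ l ≤ D := by
    have hφ0 : (0 : ℝ) < (p ^ l).totient := by
      exact_mod_cast Nat.totient_pos.mpr (pow_pos hp.pos _)
    unfold completeSumBound
    push_cast
    rw [div_mul_eq_mul_div, div_le_iff₀ (by positivity)]
    refine le_of_mul_le_mul_right ?_ hp0
    calc (eighthRoots (p ^ l) * eighthPairs (p ^ l) * w ^ l : ℝ) * p
        ≤ R * (c * w ^ (9 * l)) * w ^ l * p := by gcongr; exact hR l
      _ = (R * c * p) * (w ^ 5) ^ l * (w ^ 5) ^ l := by ring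
      _ ≤ D * (p - 1) * p ^ l * p ^ l := by rw [hw]; gcongr
      _ = D * p ^ l * (p ^ l * (p - 1)) := by ring
      _ = _ := by rw [← hφ]; ring
  calc completeSumBound (p ^ l) ^ 5 * (p ^ l : ℕ) = (completeSumBound (p ^ l) * w ^ l) ^ 5 := by
        push_cast
        rw [← hw]; ring
    _ ≤ _ := by
        have := completeSumBound_nonneg (p ^ l)
        gcongr

theorem exists_pow_five_eq {p : ℕ} (hp : 0 < p) : ∃ w : ℝ, 0 < w ∧ w ^ 5 = p := by
  refine ⟨(p : ℝ) ^ ((5 : ℕ) : ℝ)⁻¹, by positivity, ?_⟩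
  exact Real.rpow_inv_natCast_pow (by positivity) (by norm_num)

theorem completeSumBound_prime_pow_le_of_large {p l : ℕ} (hp : p.Prime) (hl : 0 < l)
    (hlarge : 1024 ≤ p) : completeSumBound (p ^ l) ^ 5 * (p ^ l : ℕ) ≤ 1 := by
  obtain ⟨w, hw0, hw⟩ := exists_pow_five_eq hp.pos
  have hp' : (1024 : ℝ) ≤ p := by exact_mod_cast hlarge
  have hw4 : 4 ≤ w := by
    by_contra! h
    have : w ^ 5 < 4 ^ 5 := by gcongr
    rw [hw] at this
    linarith
  have e2 : (w ^ 2)⁻¹ ≤ 1 / 16 := by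
    rw [inv_le_comm₀ (by positivity) (by norm_num)]
    nlinarith
  have e0 : 0 < (w ^ 2)⁻¹ := by positivity
  have e4 : (w ^ 4)⁻¹ ≤ 1 / 256 := by
    have : (w ^ 4)⁻¹ = ((w ^ 2)⁻¹) ^ 2 := by rw [inv_pow, ← pow_mul]
    rw [this]
    nlinarith
  have e36 : (w ^ 36)⁻¹ ≤ (w ^ 4)⁻¹ := by
    refine inv_anti₀ (by positivity) (pow_le_pow_right₀ (by linarith) (by norm_num))
  have := completeSumBound_prime_pow_le hp (c := 3 / 32) (R := 8) (D := 1) hw (by linarith)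
    (fun l => by exact_mod_cast eighthRoots_prime_pow_le hp (by omega) l)
    (by linarith) (by linarith) hl (by linarith)
  simpa using this

theorem completeSumBound_prime_pow_le_of_prime {p l : ℕ} (hp : p.Prime) (hl : 0 < l) :
    completeSumBound (p ^ l) ^ 5 * (p ^ l : ℕ) ≤ 2 ^ 50 := by
  obtain ⟨w, hw0, hw⟩ := exists_pow_five_eq hp.pos
  have hp' : (2 : ℝ) ≤ p := by exact_mod_cast hp.two_le
  have hw2 : (1.3 : ℝ) ≤ w ^ 2 := by
    by_contra! h
    have : (w ^ 2) ^ 5 < 1.3 ^ 5 := by gcongr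
    have h2 : (w ^ 2) ^ 5 = (w ^ 5) ^ 2 := by ring
    rw [h2, hw] at this
    nlinarith
  have hw1 : 1 ≤ w := by nlinarith
  have e2 : (w ^ 2)⁻¹ ≤ 10 / 13 := by
    rw [inv_le_comm₀ (by positivity) (by norm_num)]
    linarith
  have e4 : (w ^ 4)⁻¹ ≤ 1 := inv_le_one_of_one_le₀ (one_le_pow₀ hw1)
  have e36 : (w ^ 36)⁻¹ ≤ 1 / 100 := by
    have : (w ^ 36)⁻¹ = ((w ^ 2)⁻¹) ^ 18 := by rw [inv_pow, ← pow_mul]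
    rw [this]
    calc ((w ^ 2)⁻¹) ^ 18 ≤ (10 / 13 : ℝ) ^ 18 := by gcongr
      _ ≤ _ := by norm_num
  have hR : ∀ l, eighthRoots (p ^ l) ≤ 16 := by
    intro l
    by_cases h2 : p = 2
    · subst h2; exact eighthRoots_two_pow_le l
    · exact (eighthRoots_prime_pow_le hp h2 l).trans (by norm_num)
  have := completeSumBound_prime_pow_le hp (c := 17) (R := 16) (D := 2 ^ 10) hw hw1
    (fun l => by exact_mod_cast hR l) (by linarith) (by linarith) hl (by linarith)
  refine this.trans (le_of_eq ?_)
  norm_num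

theorem card_filter_prime_range_le : #{p ∈ range 1024 | p.Prime} ≤ 172 := by
  have h : #{p ∈ range 1024 | 2 ≤ p ∧
      ∀ q ∈ ([2, 3, 5, 7, 11, 13, 17, 19, 23, 29, 31] : List ℕ), q ∣ p → q = p} = 172 := by
    decide +kernel
  rw [← h]
  refine card_le_card fun p hp => ?_
  rw [mem_filter] at hp ⊢
  refine ⟨hp.1, hp.2.two_le, fun q hq hqp => ?_⟩
  refine ((Nat.dvd_prime hp.2).mp hqp).resolve_left ?_
  rintro rfl
  simp at hq

theorem completeSumBound_pow_mul_le {d : ℕ} (hd : 0 < d) :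
    completeSumBound d ^ 5 * d ≤ 2 ^ 8600 := by
  have hprod : completeSumBound d ^ 5 * d ≤ ∏ p ∈ d.primeFactors, if p < 1024 then 2 ^ 50 else 1 := by
    induction d using Nat.recOnPosPrimePosCoprime with
    | zero => omega
    | one =>
      have h1 : completeSumBound 1 = 1 := by
        simp [completeSumBound, eighthRoots_eq_card, eighthPairs_eq_card, Nat.modEq_one,
          Finset.univ_unique]
        rfl
      simp [h1]
    | prime_pow p l hp hl =>
      rw [Nat.primeFactors_prime_pow hl.ne' hp, prod_singleton]
      split_ifs with h
      · exact completeSumBound_prime_pow_le_of_prime hp hl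
      · exact completeSumBound_prime_pow_le_of_large hp hl (by omega)
    | coprime a b ha hb hab iha ihb =>
      rw [hab.primeFactors_mul, prod_union hab.disjoint_primeFactors, completeSumBound_mul hab]
      have h1 := iha (by omega)
      have h2 := ihb (by omega)
      have h3 := completeSumBound_nonneg a
      have h4 := completeSumBound_nonneg b
      calc _ = (completeSumBound a ^ 5 * a) * (completeSumBound b ^ 5 * b) := by push_cast; ring
        _ ≤ _ := by gcongr
  refine hprod.trans ?_
  rw [← prod_filter, prod_const]
  calc (2 ^ 50 : ℝ) ^ #{p ∈ d.primeFactors | p < 1024} ≤ (2 ^ 50 : ℝ) ^ 172 := by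
        refine pow_le_pow_right₀ (by norm_num) (le_trans ?_ card_filter_prime_range_le)
        refine card_le_card fun p hp => ?_
        rw [mem_filter] at hp ⊢
        exact ⟨mem_range.mpr hp.2, Nat.prime_of_mem_primeFactors hp.1⟩
    _ = _ := by rw [← pow_mul]

/-- Complete eighth-power sums modulo `d` are `O(d ^ (9 / 10))`. -/
theorem norm_sum_expo_complete_pow_le {d : ℕ} (hd : 0 < d) {b : ℤ} (hb : IsCoprime b d) :
    (‖∑ x ∈ range d, expo (b * (x : ℝ) ^ 8 / d)‖ / d) ^ 10 * d ≤ 2 ^ 8600 := by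
  have : NeZero d := ⟨hd.ne'⟩
  have hd' : (0 : ℝ) < d := by exact_mod_cast hd
  have hu : IsUnit (b : ZMod d) := by
    rw [ZMod.coe_int_isUnit_iff_isCoprime]
    exact hb.symm
  obtain ⟨u, hu⟩ := hu
  have hsum : ∑ x ∈ range d, expo (b * (x : ℝ) ^ 8 / d) =
      ∑ x : ZMod d, ZMod.stdAddChar ((u : ZMod d) * x ^ 8) := by
    refine sum_nbij' (fun x => (x : ZMod d)) (fun x => x.val) (fun _ _ => mem_univ _)
      (fun x _ => mem_range.mpr (ZMod.val_lt x))
      (fun x hx => by simp [ZMod.val_natCast, Nat.mod_eq_of_lt (mem_range.mp hx)])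
      (fun x _ => by simp) (fun x _ => ?_)
    have := ZMod.stdAddChar_coe (N := d) (b * (x : ℤ) ^ 8)
    rw [hu]
    push_cast at this
    rw [this, expo]
    congr 1
    push_cast
    ring
  have h := norm_sum_stdAddChar_sq_mul_totient_le d u
  rw [← hsum] at h
  set s := ‖∑ x ∈ range d, expo (b * (x : ℝ) ^ 8 / d)‖
  have hφ0 : (0 : ℝ) < d.totient := by exact_mod_cast Nat.totient_pos.mpr hd
  have h2 : (s / d) ^ 2 ≤ completeSumBound d := by
    rw [completeSumBound, div_pow, div_le_div_iff₀ (by positivity) (by positivity)]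
    nlinarith
  calc (s / d) ^ 10 * d = ((s / d) ^ 2) ^ 5 * d := by ring
    _ ≤ completeSumBound d ^ 5 * d := by gcongr
    _ ≤ _ := completeSumBound_pow_mul_le hd

theorem isRepr_zero : IsRepr 0 0 8 := ⟨Fin.elim0, fun i => i.elim0, rfl⟩

theorem isRepr_pow {x : ℕ} (hx : 0 < x) : IsRepr (x ^ 8) 1 8 :=
  ⟨fun _ => x, fun _ => hx, by simp⟩

theorem isRepr_sum_pow {j : ℕ} {a : Fin j → ℕ} (ha : ∀ i, 0 < a i) :
    IsRepr (∑ i, a i ^ 8) j 8 := ⟨a, ha, rfl⟩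

theorem _root_.IsRepr.add {m n i j : ℕ} (hm : IsRepr m i 8) (hn : IsRepr n j 8) :
    IsRepr (m + n) (i + j) 8 := by
  obtain ⟨a, ha, rfl⟩ := hm
  obtain ⟨b, hb, rfl⟩ := hn
  refine ⟨Fin.append a b, fun t => ?_, ?_⟩
  · refine Fin.addCases (fun t => ?_) (fun t => ?_) t <;> simp [ha, hb]
  · rw [Fin.sum_univ_add]
    simp

theorem _root_.IsRepr.pow_mul {n j c : ℕ} (hn : IsRepr n j 8) (hc : 0 < c) :
    IsRepr (c ^ 8 * n) j 8 := by
  obtain ⟨a, ha, rfl⟩ := hn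
  exact ⟨fun i => c * a i, fun i => mul_pos hc (ha i), by simp [mul_pow, mul_sum]⟩

theorem isRepr_self (j : ℕ) : IsRepr j j 8 := ⟨fun _ => 1, fun _ => one_pos, by simp⟩

theorem isRepr_succ_iff {n j : ℕ} :
    IsRepr n (j + 1) 8 ↔ ∃ x > 0, x ^ 8 ≤ n ∧ IsRepr (n - x ^ 8) j 8 := by
  constructor
  · rintro ⟨a, ha, rfl⟩
    refine ⟨a 0, ha 0, ?_, fun i => a i.succ, fun i => ha _, ?_⟩
    all_goals simp only [Fin.sum_univ_succ]; omega
  · rintro ⟨x, hx, hle, h⟩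
    have := h.add (isRepr_pow hx)
    rwa [Nat.sub_add_cancel hle] at this

theorem add_one_pow_eight_ge (x : ℕ) : x ^ 8 + 8 * x ^ 7 ≤ (x + 1) ^ 8 := by
  have : (x + 1) ^ 8 = x ^ 8 + 8 * x ^ 7 + (28 * x ^ 6 + 56 * x ^ 5 + 70 * x ^ 4 + 56 * x ^ 3
    + 28 * x ^ 2 + 8 * x + 1) := by ring
  omega

theorem exists_pow_eight_near {M : ℕ} (hM : 2 ≤ M) :
    ∃ m, 0 < m ∧ 64 * m ^ 8 ≤ M ^ 7 ∧ M ^ 7 ≤ 2 ^ 14 * m ^ 8 := by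
  have hex : ∃ m, M ^ 7 < 64 * (m + 1) ^ 8 := ⟨M, by
    have : M ^ 7 ≤ (M + 1) ^ 8 := Nat.pow_le_pow_left (Nat.le_succ M) 7 |>.trans
      (Nat.pow_le_pow_right (by omega) (by omega))
    have : 0 < (M + 1) ^ 8 := by positivity
    omega⟩
  classical
  set m := Nat.find hex with hm
  have hspec : M ^ 7 < 64 * (m + 1) ^ 8 := Nat.find_spec hex
  have hpos : 0 < m := by
    by_contra h0
    have : m = 0 := by omega
    rw [this] at hspec
    have : 2 ^ 7 ≤ M ^ 7 := Nat.pow_le_pow_left hM 7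
    omega
  refine ⟨m, hpos, ?_, ?_⟩
  · have := Nat.find_min hex (m := m - 1) (by omega)
    rw [Nat.sub_add_cancel hpos] at this
    omega
  · have : (m + 1) ^ 8 ≤ (2 * m) ^ 8 := Nat.pow_le_pow_left (by omega) 8
    rw [mul_pow] at this
    omega

/-- Diminishing ranges: a dense set of sums of `k + 1` eighth powers below `2 ^ 9 * M ^ 8`. -/
theorem exists_dense_sums {k : ℕ} (hk : k < 500) {M : ℕ} (hM : 0 < M) :
    ∃ (U : Finset ℕ) (m : ℕ), (∀ n ∈ U, IsRepr n (k + 1) 8) ∧ (∀ n ∈ U, n < 2 ^ 9 * M ^ 8) ∧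
      M ^ 8 ≤ #U * m ^ 7 * 2 ^ (14 * k) ∧ m ^ 8 ^ k ≤ M ^ 7 ^ k := by
  induction k generalizing M with
  | zero =>
    refine ⟨(Ioc M (2 * M)).image (· ^ 8), M, fun n hn => ?_, fun n hn => ?_, ?_, by simp⟩
    · obtain ⟨x, hx, rfl⟩ := mem_image.mp hn
      exact isRepr_pow (by have := mem_Ioc.mp hx; omega)
    · obtain ⟨x, hx, rfl⟩ := mem_image.mp hn
      have : x ^ 8 ≤ (2 * M) ^ 8 := Nat.pow_le_pow_left (mem_Ioc.mp hx).2 8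
      rw [mul_pow] at this
      have : 0 < M ^ 8 := by positivity
      omega
    · rw [card_image_of_injective _ (Nat.pow_left_injective (by norm_num)), Nat.card_Ioc]
      have : 2 * M - M = M := by omega
      rw [this]
      exact le_of_eq (by ring)
  | succ k ih =>
    rcases Nat.lt_or_ge M 2 with hM1 | hM2
    · have hM1 : M = 1 := by omega
      subst hM1
      refine ⟨{k + 1 + 1}, 1, fun n hn => ?_, fun n hn => ?_, ?_, by simp⟩
      · rw [mem_singleton.mp hn]; exact isRepr_self _
      · rw [mem_singleton.mp hn]; omega
      · simpa using Nat.one_le_two_pow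
    · obtain ⟨M', hM', hlow, hhigh⟩ := exists_pow_eight_near hM2
      obtain ⟨U', m, hrep, hlt, hcard, hm⟩ := ih (by omega) hM'
      have htail : ∀ u ∈ U', u < 8 * M ^ 7 := fun u hu => by
        have := hlt u hu
        omega
      have hinj : Set.InjOn (fun z : ℕ × ℕ => z.1 ^ 8 + z.2) ↑(Ioc M (2 * M) ×ˢ U') := by
        have hlt' : ∀ x u y w, M < x → u < 8 * M ^ 7 → x < y → x ^ 8 + u < y ^ 8 + w := by
          intro x u y w hx hu hxy
          have h1 := add_one_pow_eight_ge x
          have h2 : (x + 1) ^ 8 ≤ y ^ 8 := Nat.pow_le_pow_left hxy 8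
          have h3 : M ^ 7 ≤ x ^ 7 := Nat.pow_le_pow_left hx.le 7
          omega
        rintro ⟨x, u⟩ hz ⟨y, w⟩ hw h
        simp only [coe_product, Set.mem_prod, coe_Ioc, Set.mem_Ioc, SetLike.mem_coe] at hz hw h
        rcases lt_trichotomy x y with hxy | rfl | hxy
        · have := hlt' x u y w hz.1.1 (htail u hz.2) hxy
          omega
        · have : u = w := by omega
          rw [this]
        · have := hlt' y w x u hw.1.1 (htail w hw.2) hxy
          omega
      refine ⟨(Ioc M (2 * M) ×ˢ U').image (fun z => z.1 ^ 8 + z.2), m, fun n hn => ?_,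
        fun n hn => ?_, ?_, ?_⟩
      · obtain ⟨z, hz, rfl⟩ := mem_image.mp hn
        rw [mem_product, mem_Ioc] at hz
        have := (isRepr_pow (x := z.1) (by omega)).add (hrep _ hz.2)
        rwa [add_comm 1] at this
      · obtain ⟨z, hz, rfl⟩ := mem_image.mp hn
        rw [mem_product, mem_Ioc] at hz
        have h1 : z.1 ^ 8 ≤ (2 * M) ^ 8 := Nat.pow_le_pow_left hz.1.2 8
        rw [mul_pow] at h1
        have h2 := htail _ hz.2
        have h3 : M ^ 7 ≤ M ^ 8 := Nat.pow_le_pow_right hM (by norm_num)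
        omega
      · rw [card_image_of_injOn hinj, card_product, Nat.card_Ioc]
        have : 2 * M - M = M := by omega
        rw [this]
        calc M ^ 8 = M * M ^ 7 := by ring
          _ ≤ M * (2 ^ 14 * (#U' * m ^ 7 * 2 ^ (14 * k))) := by
            refine Nat.mul_le_mul_left _ (hhigh.trans (Nat.mul_le_mul_left _ hcard))
          _ = _ := by ring
      · calc m ^ 8 ^ (k + 1) = (m ^ 8 ^ k) ^ 8 := by rw [← pow_mul, pow_succ]
          _ ≤ (M' ^ 7 ^ k) ^ 8 := Nat.pow_le_pow_left hm 8
          _ = (M' ^ 8) ^ 7 ^ k := by rw [← pow_mul, ← pow_mul, mul_comm]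
          _ ≤ (M ^ 7) ^ 7 ^ k := Nat.pow_le_pow_left (by omega) _
          _ = _ := by rw [← pow_mul, pow_succ']

theorem sum_range_mul_le_of_blocks {h : ℕ → ℝ} {d : ℕ} {B : ℝ}
    (hB : ∀ u, ∑ i ∈ range d, h (u + i) ≤ B) (k : ℕ) : ∑ i ∈ range (d * k), h i ≤ k * B := by
  induction k with
  | zero => simp
  | succ k ih =>
    rw [mul_add_one, sum_range_add]
    have := hB (d * k)
    push_cast
    linarith

/-- Mean square over a block of length `d` near a rational with denominator `d > Y ^ 8`. -/
theorem sum_norm_sq_block_le {d Y : ℕ} (hY : 0 < Y) (hYd : Y ^ 8 < d) {b : ℤ}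
    (hb : IsCoprime b d) {α : ℝ} (hα : 7 * (Y * (|α - b / d| * (Y ^ 8 * d))) ≤ 1) (u : ℕ) :
    ∑ i ∈ range d, ‖∑ x ∈ Icc 1 Y, expo (α * ((x : ℝ) ^ 8 * (u + i : ℕ)))‖ ^ 2 ≤
      4 * d * Y := by
  have hd : 0 < d := by omega
  have hd' : (0 : ℝ) < d := by exact_mod_cast hd
  set f : ℕ → ℂ := fun i => ∑ x ∈ Icc 1 Y,
    expo (α * ((x : ℝ) ^ 8 * u)) * expo (i * (((b * (x : ℤ) ^ 8 : ℤ) : ℝ) / d)) with hf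
  have hpars : ∑ i ∈ range d, ‖f i‖ ^ 2 = d * Y := by
    rw [hf, sum_norm_sq_sum_expo hd (Icc 1 Y) (fun x : ℕ => b * (x : ℤ) ^ 8)]
    · simp
    · intro x hx y hy hxy
      rw [mem_Icc] at hx hy
      rw [← mul_sub] at hxy
      have h1 : (d : ℤ) ∣ (x : ℤ) ^ 8 - (y : ℤ) ^ 8 := hb.symm.dvd_of_dvd_mul_left hxy
      have h2 : y ^ 8 ≡ x ^ 8 [MOD d] := by
        rw [← Int.natCast_modEq_iff]
        push_cast
        exact Int.modEq_iff_dvd.mpr h1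
      have hlt : ∀ z, z ≤ Y → z ^ 8 < d := fun z hz => (Nat.pow_le_pow_left hz 8).trans_lt hYd
      exact (Nat.pow_left_injective (by norm_num : 8 ≠ 0)
        (h2.eq_of_lt_of_lt (hlt y hy.2) (hlt x hx.2))).symm
  have hdiff : ∀ i ∈ range d,
      ‖∑ x ∈ Icc 1 Y, expo (α * ((x : ℝ) ^ 8 * (u + i : ℕ))) - f i‖ ≤ 1 := by
    intro i hi
    rw [hf, ← sum_sub_distrib]
    refine (norm_sum_le _ _).trans ?_
    have hterm : ∀ x ∈ Icc 1 Y, ‖expo (α * ((x : ℝ) ^ 8 * (u + i : ℕ))) -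
        expo (α * ((x : ℝ) ^ 8 * u)) * expo (i * (((b * (x : ℤ) ^ 8 : ℤ) : ℝ) / d))‖ ≤
        7 * (|α - b / d| * (Y ^ 8 * d)) := by
      intro x hx
      rw [← expo_add]
      refine (norm_expo_sub_expo_le _ _).trans ?_
      have e : α * ((x : ℝ) ^ 8 * (u + i : ℕ)) - (α * ((x : ℝ) ^ 8 * u) +
          i * (((b * (x : ℤ) ^ 8 : ℤ) : ℝ) / d)) = (α - b / d) * ((x : ℝ) ^ 8 * i) := by
        push_cast; ring
      rw [e, abs_mul, abs_of_nonneg (by positivity : (0 : ℝ) ≤ (x : ℝ) ^ 8 * i)]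
      have hpi : 2 * Real.pi ≤ 7 := by linarith [Real.pi_lt_d2]
      have hx' : (x : ℝ) ≤ Y := by exact_mod_cast (mem_Icc.mp hx).2
      have hi' : (i : ℝ) ≤ d := by exact_mod_cast (mem_range.mp hi).le
      gcongr
    refine (sum_le_sum hterm).trans ?_
    rw [sum_const, Nat.card_Icc, nsmul_eq_mul, Nat.add_sub_cancel]
    linarith
  have hsq : ∀ i ∈ range d, ‖∑ x ∈ Icc 1 Y, expo (α * ((x : ℝ) ^ 8 * (u + i : ℕ)))‖ ^ 2 ≤
      2 * ‖f i‖ ^ 2 + 2 := by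
    intro i hi
    have h1 := hdiff i hi
    have h2 := norm_sub_norm_le (∑ x ∈ Icc 1 Y, expo (α * ((x : ℝ) ^ 8 * (u + i : ℕ)))) (f i)
    have h3 : ‖∑ x ∈ Icc 1 Y, expo (α * ((x : ℝ) ^ 8 * (u + i : ℕ)))‖ ≤ ‖f i‖ + 1 := by linarith
    calc _ ≤ (‖f i‖ + 1) ^ 2 := by gcongr
      _ ≤ _ := by nlinarith [sq_nonneg (‖f i‖ - 1)]
  refine (sum_le_sum hsq).trans ?_
  rw [sum_add_distrib, ← mul_sum, hpars, sum_const, card_range, nsmul_eq_mul]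
  have : (1 : ℝ) ≤ Y := by exact_mod_cast hY
  nlinarith

/-- Minor-arc estimate for a bilinear sum. -/
theorem norm_sum_bilinear_sq_le {d Y N : ℕ} (hY : 0 < Y) (hYd : Y ^ 8 < d) {b : ℤ}
    (hb : IsCoprime b d) {α : ℝ} (hα : 7 * (Y * (|α - b / d| * (Y ^ 8 * d))) ≤ 1)
    {U : Finset ℕ} (hU : ∀ u ∈ U, u < N) :
    ‖∑ x ∈ Icc 1 Y, ∑ u ∈ U, expo (α * ((x : ℝ) ^ 8 * u))‖ ^ 2 ≤
      #U * (4 * (N + d) * Y) := by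
  have hd : 0 < d := by omega
  have hd' : (0 : ℝ) < d := by exact_mod_cast hd
  set h : ℕ → ℝ := fun u => ‖∑ x ∈ Icc 1 Y, expo (α * ((x : ℝ) ^ 8 * u))‖ ^ 2 with hh
  have hsub : U ⊆ range (d * (N / d + 1)) := fun u hu => by
    rw [mem_range]
    exact (hU u hu).trans (Nat.lt_mul_div_succ N hd)
  rw [sum_comm]
  calc ‖∑ u ∈ U, ∑ x ∈ Icc 1 Y, expo (α * ((x : ℝ) ^ 8 * u))‖ ^ 2
      ≤ (∑ u ∈ U, ‖∑ x ∈ Icc 1 Y, expo (α * ((x : ℝ) ^ 8 * u))‖) ^ 2 := by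
        gcongr; exact norm_sum_le _ _
    _ ≤ #U * ∑ u ∈ U, h u := sq_sum_le_card_mul_sum_sq
    _ ≤ #U * ∑ u ∈ range (d * (N / d + 1)), h u := by
        gcongr
    _ ≤ #U * (((N / d + 1 : ℕ) : ℝ) * (4 * d * Y)) := by
        gcongr
        exact sum_range_mul_le_of_blocks (fun u => sum_norm_sq_block_le hY hYd hb hα u) _
    _ ≤ #U * (((N : ℝ) / d + 1) * (4 * d * Y)) := by
        gcongr
        push_cast
        gcongr
        exact Nat.cast_div_le
    _ = _ := by field_simp

/-- Dirichlet approximation of `a / q`, in integers. -/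
theorem exists_dirichlet_approx {a q D : ℕ} (ha : a < q) (hD : 0 < D) (hDq : D < q) :
    ∃ d b : ℕ, 0 < d ∧ d * D ≤ q ∧ b ≤ d ∧ IsCoprime (b : ℤ) d ∧
      |(a : ℤ) * d - b * q| ≤ D := by
  have hq : (0 : ℝ) < q := by exact_mod_cast (by omega : 0 < q)
  have hn : 0 < q / D := Nat.div_pos hDq.le hD
  obtain ⟨r, hr, hden⟩ := Real.exists_rat_abs_sub_le_and_den_le ((a : ℝ) / q) hn
  have hd : (0 : ℝ) < r.den := by exact_mod_cast r.den_pos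
  have hqD : (q : ℝ) ≤ D * (((q / D : ℕ) : ℝ) + 1) := by
    exact_mod_cast (Nat.lt_mul_div_succ q hD).le
  have hj : |(a : ℤ) * r.den - r.num * q| ≤ D := by
    have h1 : |(a : ℝ) * r.den - r.num * q| ≤ D := by
      have e : (a : ℝ) * r.den - r.num * q = ((a : ℝ) / q - r) * (q * r.den) := by
        have hrc : (r : ℝ) = r.num / r.den := by exact_mod_cast (Rat.num_div_den r).symm
        rw [hrc]
        field_simp
      rw [e, abs_mul, abs_of_pos (by positivity : (0 : ℝ) < q * r.den)]
      calc _ ≤ 1 / ((((q / D : ℕ) : ℝ) + 1) * r.den) * (q * r.den) := by gcongr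
        _ = q / (((q / D : ℕ) : ℝ) + 1) := by field_simp
        _ ≤ D := by rwa [div_le_iff₀ (by positivity)]
    exact_mod_cast h1
  have ha' : (a : ℤ) + 1 ≤ q := by exact_mod_cast ha
  have hD' : (D : ℤ) < q := by exact_mod_cast hDq
  have hd' : (0 : ℤ) < r.den := by exact_mod_cast r.den_pos
  rw [abs_le] at hj
  have hnum0 : 0 ≤ r.num := by
    by_contra! h
    have : (0 : ℤ) ≤ a * r.den := by positivity
    nlinarith
  have hnum1 : r.num ≤ r.den := by
    by_contra! h
    nlinarith
  obtain ⟨b, hb⟩ := Int.eq_ofNat_of_zero_le hnum0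
  rw [hb] at hj hnum1
  refine ⟨r.den, b, r.den_pos, (Nat.le_div_iff_mul_le hD).mp hden, by exact_mod_cast hnum1, ?_,
    abs_le.mpr hj⟩
  rw [← hb]
  exact Rat.isCoprime_num_den r

theorem pow_fifty_le {x G w η L : ℝ} {d : ℕ} (hx : 0 ≤ x) (hG : 0 ≤ G) (hw : 0 ≤ w) (hη : 0 ≤ η)
    (hd : 0 < d) (h : x ≤ G * min 1 w + η) (hGL : G ^ 10 * d ≤ L) :
    x ^ 50 ≤ 2 ^ 49 * (L ^ 5 / d ^ 5 * w ^ 2 + η ^ 50) := by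
  have hd' : (0 : ℝ) < d := by exact_mod_cast hd
  have hm : 0 ≤ min 1 w := le_min zero_le_one hw
  have h1 : (min 1 w) ^ 50 ≤ w ^ 2 := by
    calc (min 1 w) ^ 50 ≤ (min 1 w) ^ 2 :=
          pow_le_pow_of_le_one hm (min_le_left _ _) (by norm_num)
      _ ≤ _ := by gcongr; exact min_le_right _ _
  have h2 : G ^ 50 ≤ L ^ 5 / d ^ 5 := by
    rw [le_div_iff₀ (by positivity)]
    calc G ^ 50 * d ^ 5 = (G ^ 10 * d) ^ 5 := by ring
      _ ≤ L ^ 5 := by gcongr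
  have hL : 0 ≤ L ^ 5 / d ^ 5 := le_trans (by positivity) h2
  calc x ^ 50 ≤ (G * min 1 w + η) ^ 50 := by gcongr
    _ ≤ 2 ^ (50 - 1) * ((G * min 1 w) ^ 50 + η ^ 50) := add_pow_le (by positivity) hη 50
    _ = 2 ^ 49 * (G ^ 50 * (min 1 w) ^ 50 + η ^ 50) := by rw [mul_pow]
    _ ≤ _ := by gcongr

/-- Pointwise bound for the normalized Weyl sum on a major arc. -/
theorem norm_weyl_major_pow_le {p Y C a d b : ℕ} {L : ℝ} (hY : 0 < Y) (hC : 0 < C)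
    (hYp : Y ^ 9 ≤ p) (hCY : 2 ^ 11 * C ^ 7 ≤ Y) (hd : 0 < d) (hdY : d ≤ Y ^ 8)
    (hj0 : (a : ℤ) * d - b * (p ^ 8 : ℕ) ≠ 0)
    (hj : |(a : ℤ) * d - b * (p ^ 8 : ℕ)| ≤ (Y ^ 8 : ℕ))
    (hL : (‖∑ x ∈ range d, expo ((b : ℤ) * (x : ℝ) ^ 8 / d)‖ / d) ^ 10 * d ≤ L) :
    (‖∑ i ∈ range (C * p), expo ((a : ℝ) / (p ^ 8 : ℕ) * ((C * p + i : ℕ) : ℝ) ^ 8)‖ /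
        (C * p : ℕ)) ^ 50 ≤
      2 ^ 49 * (L ^ 5 / (16 * C ^ 16) *
        (1 / (d ^ 3 * (((a : ℤ) * d - b * (p ^ 8 : ℕ)).natAbs : ℝ) ^ 2)) +
          (2 ^ 12 * C ^ 7 / Y) ^ 50) := by
  have hp : 0 < p := lt_of_lt_of_le (by positivity) hYp
  have hp' : (0 : ℝ) < p := by exact_mod_cast hp
  have hd' : (0 : ℝ) < d := by exact_mod_cast hd
  have hC' : (0 : ℝ) < C := by exact_mod_cast hC
  have hC1 : (1 : ℝ) ≤ C := by exact_mod_cast hC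
  have hY' : (0 : ℝ) < Y := by exact_mod_cast hY
  have hYp' : (Y : ℝ) ^ 9 ≤ p := by exact_mod_cast hYp
  have hCY' : (2 : ℝ) ^ 11 * C ^ 7 ≤ Y := by exact_mod_cast hCY
  have hdY' : (d : ℝ) ≤ Y ^ 8 := by exact_mod_cast hdY
  set j : ℤ := (a : ℤ) * d - b * (p ^ 8 : ℕ) with hjdef
  set k : ℝ := (j.natAbs : ℝ) with hk
  have hkabs : |(j : ℝ)| = k := by rw [hk, Nat.cast_natAbs, Int.cast_abs]
  have hk0 : 0 < k := by rw [← hkabs]; exact abs_pos.mpr (by exact_mod_cast hj0)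
  have hkY : k ≤ Y ^ 8 := by
    rw [← hkabs]
    exact_mod_cast hj
  set β : ℝ := (j : ℝ) / (p ^ 8 * d) with hβ
  have hβabs : |β| = k / (p ^ 8 * d) := by
    rw [hβ, abs_div, hkabs, abs_of_pos (by positivity)]
  have hβ0 : β ≠ 0 := by rw [← abs_pos, hβabs]; positivity
  have hα : (a : ℝ) / (p ^ 8 : ℕ) = ((b : ℤ) : ℝ) / d + β := by
    rw [hβ, hjdef]
    push_cast
    field_simp
    ring
  have hX : 0 < C * p := by positivity
  have hβX : |β| * (2 * (C * p : ℕ)) ^ 8 = 2 ^ 8 * C ^ 8 * k / d := by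
    rw [hβabs]; push_cast; field_simp
  have hsmall : 8 * |β| * (2 * (C * p : ℕ)) ^ 7 ≤ 1 / 2 := by
    have e : 8 * |β| * (2 * (C * p : ℕ)) ^ 7 = 2 ^ 10 * C ^ 7 * k / (p * d) := by
      rw [hβabs]; push_cast; field_simp; ring
    rw [e, div_le_div_iff₀ (by positivity) (by norm_num)]
    have h1 : (1 : ℝ) ≤ d := by exact_mod_cast hd
    calc 2 ^ 10 * (C : ℝ) ^ 7 * k * (2 : ℝ) = (2 ^ 11 * (C : ℝ) ^ 7) * k := by ring
      _ ≤ (Y : ℝ) * (Y : ℝ) ^ 8 := by gcongr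
      _ = (Y : ℝ) ^ 9 := by ring
      _ ≤ (p : ℝ) := hYp'
      _ ≤ 1 * ((p : ℝ) * d) := by nlinarith
  have h := norm_sum_expo_major_le hd hX (b : ℤ) hβ0 hsmall (le_of_eq (div_mul_cancel₀ _ hd'.ne').symm)
  rw [← hα, hβX] at h
  have hres : ‖∑ i ∈ range (C * p), expo ((a : ℝ) / (p ^ 8 : ℕ) * ((C * p + i : ℕ) : ℝ) ^ 8)‖ /
      (C * p : ℕ) ≤ ‖∑ x ∈ range d, expo ((b : ℤ) * (x : ℝ) ^ 8 / d)‖ / d *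
        min 1 (d / (4 * k * C ^ 8)) + 2 ^ 12 * C ^ 7 / Y := by
    have hX' : (0 : ℝ) < (C * p : ℕ) := by exact_mod_cast hX
    rw [div_le_iff₀ hX', add_mul]
    refine h.trans (add_le_add (le_of_eq ?_) ?_)
    · rw [mul_assoc (_ / _) (min _ _), min_mul_of_nonneg _ _ hX'.le, one_mul]
      congr 2
      rw [hβabs]
      push_cast
      field_simp
    · have hpi := Real.pi_lt_d2
      calc 2 * (d : ℝ) * (1 + 2 * Real.pi * (2 ^ 8 * (C : ℝ) ^ 8 * k / d))
          = 2 * d + 2 ^ 10 * Real.pi * (C : ℝ) ^ 8 * k := by field_simp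
        _ ≤ 2 * (Y : ℝ) ^ 8 + 2 ^ 10 * 3.15 * (C : ℝ) ^ 8 * (Y : ℝ) ^ 8 := by gcongr
        _ ≤ 2 * (C : ℝ) ^ 8 * (Y : ℝ) ^ 8 + 2 ^ 10 * 3.15 * (C : ℝ) ^ 8 * (Y : ℝ) ^ 8 := by
            have : (1 : ℝ) ≤ (C : ℝ) ^ 8 := one_le_pow₀ hC1
            gcongr
            linarith
        _ ≤ 2 ^ 12 * (C : ℝ) ^ 8 * (Y : ℝ) ^ 8 := by
            have : (0 : ℝ) < (C : ℝ) ^ 8 * (Y : ℝ) ^ 8 := by positivity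
            nlinarith
        _ = 2 ^ 12 * (C : ℝ) ^ 7 / (Y : ℝ) * ((C : ℝ) * (Y : ℝ) ^ 9) := by field_simp
        _ ≤ 2 ^ 12 * (C : ℝ) ^ 7 / (Y : ℝ) * ((C * p : ℕ) : ℝ) := by push_cast; gcongr
  refine (pow_fifty_le (by positivity) (by positivity) (by positivity) (by positivity) hd hres
    hL).trans (le_of_eq ?_)
  congr 2
  field_simp
  ring

theorem sum_Ioo_inv_sq_le_two (n : ℕ) : ∑ k ∈ Ioo 0 n, 1 / (k : ℝ) ^ 2 ≤ 2 := by
  have := sum_Ioo_inv_sq_le (α := ℝ) 0 n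
  simpa using this

/-- Summation over all major-arc approximations. -/
theorem sum_major_weights_le {q D : ℕ} {A : Finset ℕ} {d b : ℕ → ℕ} {κ ε : ℝ} (hκ : 0 ≤ κ)
    (hε : 0 ≤ ε) (hd : ∀ a ∈ A, 0 < d a) (hdD : ∀ a ∈ A, d a ≤ D) (hb : ∀ a ∈ A, b a ≤ d a)
    (hj0 : ∀ a ∈ A, (a : ℤ) * d a - b a * q ≠ 0)
    (hj : ∀ a ∈ A, |(a : ℤ) * d a - b a * q| ≤ D) :
    ∑ a ∈ A, (κ * (1 / ((d a : ℝ) ^ 3 * (((a : ℤ) * d a - b a * q).natAbs : ℝ) ^ 2)) + ε) ≤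
      16 * κ + 4 * D ^ 3 * ε := by
  set T : Finset (Σ _ : ℕ, ℕ × ℕ × Bool) :=
    (Ioo 0 (D + 1)).sigma fun d => range (d + 1) ×ˢ Ioo 0 (D + 1) ×ˢ univ with hT
  set g : ℕ → Σ _ : ℕ, ℕ × ℕ × Bool := fun a =>
    ⟨d a, b a, ((a : ℤ) * d a - b a * q).natAbs, decide (0 ≤ (a : ℤ) * d a - b a * q)⟩ with hg
  set F : (Σ _ : ℕ, ℕ × ℕ × Bool) → ℝ := fun z =>
    κ * (1 / ((z.1 : ℝ) ^ 3 * (z.2.2.1 : ℝ) ^ 2)) + ε with hF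
  have hinj : Set.InjOn g A := by
    intro x hx y hy hxy
    simp only [hg, Sigma.mk.injEq, heq_eq_eq, Prod.mk.injEq, decide_eq_decide] at hxy
    obtain ⟨h1, h2, h3, h4⟩ := hxy
    have h5 : (x : ℤ) * d x - b x * q = (y : ℤ) * d y - b y * q := by omega
    rw [h1, h2] at h5
    have h6 : ((x : ℤ) - y) * d y = 0 := by linarith
    have h7 : (d y : ℤ) ≠ 0 := by exact_mod_cast (hd y hy).ne'
    have := (mul_eq_zero.mp h6).resolve_right h7
    omega
  have hmaps : A.image g ⊆ T := by
    intro z hz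
    obtain ⟨a, ha, rfl⟩ := mem_image.mp hz
    have h1 := hd a ha
    have h2 := hdD a ha
    have h3 := hb a ha
    have h4 := hj0 a ha
    have h5 := hj a ha
    simp only [hT, hg, mem_sigma, mem_product, mem_Ioo, mem_range, mem_univ, and_true]
    rw [Int.abs_eq_natAbs] at h5
    omega
  have hsum : ∑ z ∈ T, F z = ∑ d ∈ Ioo 0 (D + 1), (d + 1 : ℝ) *
      (2 * (κ / d ^ 3 * ∑ k ∈ Ioo 0 (D + 1), 1 / (k : ℝ) ^ 2) + 2 * D * ε) := by
    rw [hT, sum_sigma]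
    refine sum_congr rfl fun d _ => ?_
    simp only [hF, sum_product, sum_const, card_range, nsmul_eq_mul]
    push_cast
    congr 1
    simp only [sum_const, card_univ, Fintype.card_bool, nsmul_eq_mul, mul_add, sum_add_distrib,
      Nat.card_Ioo]
    congr 1
    · rw [mul_sum, mul_sum]
      refine sum_congr rfl fun k _ => ?_
      rw [div_mul_div_comm, mul_one, mul_one_div]
      norm_num
    · push_cast [Nat.add_sub_cancel]
      ring
  have hterm : ∀ d ∈ Ioo 0 (D + 1), (d + 1 : ℝ) *
      (2 * (κ / d ^ 3 * ∑ k ∈ Ioo 0 (D + 1), 1 / (k : ℝ) ^ 2) + 2 * D * ε) ≤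
      8 * κ * (1 / (d : ℝ) ^ 2) + 4 * D ^ 2 * ε := by
    intro d hd
    rw [mem_Ioo] at hd
    have hd0 : (0 : ℝ) < d := by exact_mod_cast hd.1
    have hd1 : (1 : ℝ) ≤ d := by exact_mod_cast hd.1
    have hdD : (d : ℝ) ≤ D := by exact_mod_cast Nat.lt_succ_iff.mp hd.2
    calc _ ≤ (2 * d : ℝ) * (2 * (κ / d ^ 3 * 2) + 2 * D * ε) := by
          gcongr
          · linarith
          · exact sum_Ioo_inv_sq_le_two _
      _ = 8 * κ * (1 / (d : ℝ) ^ 2) + 4 * D * d * ε := by field_simp; ring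
      _ ≤ 8 * κ * (1 / (d : ℝ) ^ 2) + 4 * D * D * ε := by gcongr
      _ = _ := by ring
  calc _ = ∑ z ∈ A.image g, F z := by rw [sum_image hinj]
    _ ≤ ∑ z ∈ T, F z := sum_le_sum_of_subset_of_nonneg hmaps fun z _ _ => by
        simp only [hF]; positivity
    _ ≤ ∑ d ∈ Ioo 0 (D + 1), (8 * κ * (1 / (d : ℝ) ^ 2) + 4 * D ^ 2 * ε) := by
        rw [hsum]; exact sum_le_sum hterm
    _ = 8 * κ * (∑ d ∈ Ioo 0 (D + 1), 1 / (d : ℝ) ^ 2) + D * (4 * D ^ 2 * ε) := by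
        rw [sum_add_distrib, ← mul_sum, sum_const, Nat.card_Ioo, nsmul_eq_mul]
        simp
    _ ≤ 8 * κ * 2 + D * (4 * D ^ 2 * ε) := by
        gcongr
        exact sum_Ioo_inv_sq_le_two _
    _ = _ := by ring

theorem expo_sum {ι : Type*} (s : Finset ι) (f : ι → ℝ) :
    expo (∑ i ∈ s, f i) = ∏ i ∈ s, expo (f i) := by
  classical
  induction s using Finset.induction_on with
  | empty => simp
  | insert a s ha ih => rw [sum_insert ha, prod_insert ha, expo_add, ih]

/-- The generating exponential sum factors. -/
theorem sum_expo_factor (V U : Finset ℕ) (Y X k : ℕ) (α : ℝ) :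
    ∑ z ∈ (V ×ˢ V) ×ˢ (Icc 1 Y ×ˢ U) ×ˢ Fintype.piFinset fun _ : Fin k => range X,
      expo (α * ((z.1.1 + z.1.2 + z.2.1.1 ^ 8 * z.2.1.2 + ∑ i, (X + z.2.2 i) ^ 8 : ℕ) : ℝ)) =
    (∑ v ∈ V, expo (α * v)) ^ 2 * (∑ x ∈ Icc 1 Y, ∑ u ∈ U, expo (α * ((x : ℝ) ^ 8 * u))) *
      (∑ i ∈ range X, expo (α * ((X + i : ℕ) : ℝ) ^ 8)) ^ k := by
  have h1 : (∑ i ∈ range X, expo (α * ((X + i : ℕ) : ℝ) ^ 8)) ^ k =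
      ∑ y ∈ Fintype.piFinset fun _ : Fin k => range X,
        expo (α * ∑ i, ((X + y i : ℕ) : ℝ) ^ 8) := by
    have := prod_univ_sum (fun _ : Fin k => range X)
      (fun _ i => expo (α * ((X + i : ℕ) : ℝ) ^ 8))
    rw [prod_const, card_univ, Fintype.card_fin] at this
    rw [this]
    refine sum_congr rfl fun y _ => ?_
    rw [mul_sum, expo_sum]
  rw [h1, ← sum_product' (Icc 1 Y) U fun x u => expo (α * ((x : ℝ) ^ 8 * u)), sq, sum_mul_sum,
    ← sum_product', mul_assoc, sum_mul_sum, ← sum_product', sum_mul_sum, ← sum_product']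
  refine sum_congr rfl fun z _ => ?_
  rw [← expo_add, ← expo_add, ← expo_add]
  congr 1
  push_cast
  ring

theorem le_of_pow_tower_le {m p : ℕ} (h : m ^ 8 ^ 41 ≤ p ^ 7 ^ 41) : m ^ 238 ≤ p := by
  rcases Nat.eq_zero_or_pos m with rfl | hm
  · simp
  have h1 : 238 * 7 ^ 41 ≤ 8 ^ 41 := by norm_num
  have h2 : (m ^ 238) ^ 7 ^ 41 ≤ p ^ 7 ^ 41 := by
    rw [← pow_mul]
    exact (Nat.pow_le_pow_right hm h1).trans h
  exact (Nat.pow_le_pow_iff_left (by positivity)).mp h2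

/-- The saving on the minor arcs beats the loss of density of the diminishing ranges. -/
theorem minor_density_le {p Y v u a b f K : ℕ} (hK : K = 2 ^ 574) (hf : 9872 ≤ f) (hY : 2 ^ f ≤ Y) (hpY : p ≤ (2 * Y) ^ 9)
    (ha : a ^ 8 ^ 41 ≤ p ^ 7 ^ 41) (hb : b ^ 8 ^ 41 ≤ p ^ 7 ^ 41)
    (hv : p ^ 8 ≤ 2 ^ 24 * (v * a ^ 7 * K))
    (hu : p ^ 8 ≤ 2 ^ 8 * Y ^ 8 * (u * b ^ 7 * K)) :
    2 ^ 16 * (p ^ 8) ^ 3 ≤ Y ^ 9 * v ^ 2 * u := by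
  have ha' := (le_of_pow_tower_le ha).trans hpY
  have hb' := (le_of_pow_tower_le hb).trans hpY
  set m := max a b with hm
  have hm' : m ^ 238 ≤ (2 * Y) ^ 9 := by
    rcases max_choice a b with h | h <;> rw [hm, h]
    exacts [ha', hb']
  have key : ∀ e : ℕ, e * 11 + 9 ≤ f * 2 → 2 ^ e * m ^ 21 ≤ Y := by
    intro e hef
    refine (Nat.pow_le_pow_iff_left (n := 11) (by norm_num)).mp ?_
    calc (2 ^ e * m ^ 21) ^ 11 = 2 ^ (e * 11) * m ^ 231 := by
          rw [mul_pow, ← pow_mul, ← pow_mul]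
      _ ≤ 2 ^ (e * 11) * (2 * Y) ^ 9 := by
          refine Nat.mul_le_mul_left _ ?_
          rcases Nat.eq_zero_or_pos m with h | h
          · rw [h, zero_pow (by norm_num)]; exact Nat.zero_le _
          · exact (Nat.pow_le_pow_right h (by norm_num : 231 ≤ 238)).trans hm'
      _ = 2 ^ (e * 11 + 9) * Y ^ 9 := by rw [mul_pow, ← mul_assoc, ← pow_add]
      _ ≤ 2 ^ (f * 2) * Y ^ 9 := by gcongr; norm_num
      _ = (2 ^ f) ^ 2 * Y ^ 9 := by rw [← pow_mul]
      _ ≤ Y ^ 2 * Y ^ 9 := by gcongr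
      _ = Y ^ 11 := by rw [← pow_add]
  have hsplit : ∀ t : ℕ, 2 ^ (72 + t * 3) = 2 ^ 72 * (2 ^ t) ^ 3 := fun t => by
    rw [pow_add, pow_mul]
  have hmY := key (72 + 574 * 3) (by omega)
  have ham : a ≤ m := le_max_left _ _
  have hbm : b ≤ m := le_max_right _ _
  rw [hsplit, ← hK] at hmY
  calc 2 ^ 16 * (p ^ 8) ^ 3 = 2 ^ 16 * (p ^ 8 * p ^ 8 * p ^ 8) := by ring
    _ ≤ 2 ^ 16 * ((2 ^ 24 * (v * a ^ 7 * K)) * (2 ^ 24 * (v * a ^ 7 * K)) *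
          (2 ^ 8 * Y ^ 8 * (u * b ^ 7 * K))) := by gcongr
    _ ≤ 2 ^ 16 * ((2 ^ 24 * (v * m ^ 7 * K)) * (2 ^ 24 * (v * m ^ 7 * K)) *
          (2 ^ 8 * Y ^ 8 * (u * m ^ 7 * K))) := by gcongr
    _ = (2 ^ 72 * K ^ 3 * m ^ 21) * (Y ^ 8 * v ^ 2 * u) := by ring
    _ ≤ Y * (Y ^ 8 * v ^ 2 * u) := by gcongr
    _ = _ := by ring

/-- Numerators on major arcs do not vanish. -/
theorem mul_sub_mul_prime_pow_ne_zero {p a d b : ℕ} (hp : p.Prime) (ha : 0 < a) (hap : a < p ^ 8)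
    (hd : 0 < d) (hdp : d < p) (hb : b ≤ d) (hbd : IsCoprime (b : ℤ) d) :
    (a : ℤ) * d - b * (p ^ 8 : ℕ) ≠ 0 := by
  intro h
  have h1 : a * d = b * p ^ 8 := by
    have : (a : ℤ) * d = b * (p ^ 8 : ℕ) := sub_eq_zero.mp h
    exact_mod_cast this
  have h2 : d.Coprime (p ^ 8) :=
    (Nat.Coprime.pow_right 8 (Nat.coprime_of_lt_prime hd.ne' hdp hp).symm)
  have h3 : d ∣ b := h2.dvd_of_dvd_mul_right (Dvd.intro_left a h1)
  have h4 : d = 1 := Nat.Coprime.eq_one_of_dvd (Nat.isCoprime_iff_coprime.mp hbd).symm h3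
  subst h4
  interval_cases b <;> omega

/-- Every frequency either has a small bilinear sum or admits a major-arc approximation. -/
theorem minor_or_major {p Y a N : ℕ} (hp : p.Prime) (hY : 2 ≤ Y) (hYp : Y ^ 9 ≤ p)
    (ha : 0 < a) (hap : a < p ^ 8) {U : Finset ℕ} (hU : ∀ u ∈ U, u < N)
    (hN : N * Y ^ 8 ≤ 2 ^ 9 * p ^ 8) :
    ‖∑ x ∈ Icc 1 Y, ∑ u ∈ U, expo ((a : ℝ) / (p ^ 8 : ℕ) * ((x : ℝ) ^ 8 * u))‖ ^ 2 * Y ^ 7 ≤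
        #U * (2 ^ 12 * p ^ 8) ∨
      ∃ d b : ℕ, 0 < d ∧ d ≤ Y ^ 8 ∧ b ≤ d ∧ IsCoprime (b : ℤ) d ∧
        (a : ℤ) * d - b * (p ^ 8 : ℕ) ≠ 0 ∧ |(a : ℤ) * d - b * (p ^ 8 : ℕ)| ≤ (Y ^ 8 : ℕ) := by
  have hY0 : 0 < Y := by omega
  have hYp8 : Y ^ 8 < p := lt_of_lt_of_le (Nat.pow_lt_pow_right (by omega) (by norm_num)) hYp
  have hpp : p ≤ p ^ 8 := Nat.le_self_pow (by norm_num) p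
  obtain ⟨d, b, hd, hdD, hbd, hco, hj⟩ :=
    exists_dirichlet_approx hap (by positivity : 0 < Y ^ 8) (by omega)
  rcases le_or_gt d (Y ^ 8) with h | h
  · exact Or.inr ⟨d, b, hd, h, hbd, hco,
      mul_sub_mul_prime_pow_ne_zero hp ha hap hd (by omega) hbd hco, hj⟩
  left
  have hY' : (0 : ℝ) < Y := by exact_mod_cast hY0
  have hd' : (0 : ℝ) < d := by exact_mod_cast hd
  have hp' : (0 : ℝ) < p := by exact_mod_cast hp.pos
  have hα : 7 * ((Y : ℝ) * (|(a : ℝ) / (p ^ 8 : ℕ) - (b : ℤ) / d| * (Y ^ 8 * d))) ≤ 1 := by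
    have e : (a : ℝ) / (p ^ 8 : ℕ) - ((b : ℤ) : ℝ) / d =
        (((a : ℤ) * d - b * (p ^ 8 : ℕ) : ℤ) : ℝ) / (p ^ 8 * d) := by
      push_cast
      field_simp
    have hj' : |(((a : ℤ) * d - b * (p ^ 8 : ℕ) : ℤ) : ℝ)| ≤ Y ^ 8 := by exact_mod_cast hj
    rw [e, abs_div, abs_of_pos (by positivity : (0 : ℝ) < p ^ 8 * d)]
    calc _ ≤ 7 * ((Y : ℝ) * ((Y : ℝ) ^ 8 / (p ^ 8 * d) * (Y ^ 8 * d))) := by gcongr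
      _ = 7 * (Y : ℝ) ^ 17 / p ^ 8 := by field_simp
      _ ≤ 1 := by
        rw [div_le_one (by positivity)]
        have h2 : (2 : ℝ) ≤ Y := by exact_mod_cast hY
        calc (7 : ℝ) * Y ^ 17 ≤ 2 ^ 55 * Y ^ 17 := by gcongr; norm_num
          _ ≤ (Y : ℝ) ^ 55 * (Y : ℝ) ^ 17 := by gcongr
          _ = ((Y : ℝ) ^ 9) ^ 8 := by ring
          _ ≤ _ := by gcongr; exact_mod_cast hYp
  have hmain := norm_sum_bilinear_sq_le hY0 h hco hα hU
  have hN' : (N : ℝ) * Y ^ 8 ≤ 2 ^ 9 * p ^ 8 := by exact_mod_cast hN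
  have hdD' : (d : ℝ) * Y ^ 8 ≤ p ^ 8 := by exact_mod_cast hdD
  calc _ ≤ (#U * (4 * (N + d) * Y)) * (Y : ℝ) ^ 7 := by gcongr
    _ = #U * (4 * (N * (Y : ℝ) ^ 8 + d * (Y : ℝ) ^ 8)) := by ring
    _ ≤ #U * (4 * (2 ^ 9 * (p : ℝ) ^ 8 + (p : ℝ) ^ 8)) := by gcongr
    _ ≤ _ := by
      have : (0 : ℝ) ≤ (p : ℝ) ^ 8 := by positivity
      refine mul_le_mul_of_nonneg_left ?_ (Nat.cast_nonneg _)
      linarith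

/-- Total contribution of the major arcs. -/
theorem sum_major_le {p Y C : ℕ} {L : ℝ} (hp : p.Prime) (hY : 0 < Y) (hC : 0 < C)
    (hYp : Y ^ 9 ≤ p) (hCY : 2 ^ 30 * C ^ 14 ≤ Y) (hLC : 2 ^ 52 * L ^ 5 ≤ C ^ 16)
    (hL : ∀ (d : ℕ) (b : ℤ), 0 < d → IsCoprime b d →
      (‖∑ x ∈ range d, expo (b * (x : ℝ) ^ 8 / d)‖ / d) ^ 10 * d ≤ L)
    {A : Finset ℕ} (hA : ∀ a ∈ A, ∃ d b : ℕ, 0 < d ∧ d ≤ Y ^ 8 ∧ b ≤ d ∧ IsCoprime (b : ℤ) d ∧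
        (a : ℤ) * d - b * (p ^ 8 : ℕ) ≠ 0 ∧ |(a : ℤ) * d - b * (p ^ 8 : ℕ)| ≤ (Y ^ 8 : ℕ)) :
    ∑ a ∈ A, ‖∑ i ∈ range (C * p),
        expo ((a : ℝ) / (p ^ 8 : ℕ) * ((C * p + i : ℕ) : ℝ) ^ 8)‖ ^ 50 ≤
      1 / 4 * ((C * p : ℕ) : ℝ) ^ 50 := by
  classical
  have hA' : ∀ a : ℕ, ∃ d b : ℕ, a ∈ A → 0 < d ∧ d ≤ Y ^ 8 ∧ b ≤ d ∧ IsCoprime (b : ℤ) d ∧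
      (a : ℤ) * d - b * (p ^ 8 : ℕ) ≠ 0 ∧ |(a : ℤ) * d - b * (p ^ 8 : ℕ)| ≤ (Y ^ 8 : ℕ) := by
    intro a
    by_cases h : a ∈ A
    · obtain ⟨d, b, h⟩ := hA a h
      exact ⟨d, b, fun _ => h⟩
    · exact ⟨0, 0, fun h' => absurd h' h⟩
  choose d b hdb using hA'
  have hY' : (0 : ℝ) < Y := by exact_mod_cast hY
  have hC' : (0 : ℝ) < C := by exact_mod_cast hC
  have hC1 : (1 : ℝ) ≤ C := by exact_mod_cast hC
  have hX' : (0 : ℝ) < ((C * p : ℕ) : ℝ) := by exact_mod_cast Nat.mul_pos hC hp.pos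
  have hCY' : (2 : ℝ) ^ 30 * C ^ 14 ≤ Y := by exact_mod_cast hCY
  have hL0 : 0 ≤ L := le_trans (by positivity) (hL 1 0 one_pos (by simpa using isCoprime_one_right))
  set κ : ℝ := L ^ 5 / (16 * C ^ 16) with hκ
  set ε : ℝ := (2 ^ 12 * C ^ 7 / Y) ^ 50 with hε
  have hCY2 : 2 ^ 11 * C ^ 7 ≤ Y := by
    refine le_trans (Nat.mul_le_mul (by norm_num) ?_) hCY
    exact Nat.pow_le_pow_right hC (by norm_num)
  have hpt : ∀ a ∈ A, ‖∑ i ∈ range (C * p),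
      expo ((a : ℝ) / (p ^ 8 : ℕ) * ((C * p + i : ℕ) : ℝ) ^ 8)‖ ^ 50 ≤
      ((C * p : ℕ) : ℝ) ^ 50 * 2 ^ 49 * (κ *
        (1 / ((d a : ℝ) ^ 3 * (((a : ℤ) * d a - b a * (p ^ 8 : ℕ)).natAbs : ℝ) ^ 2)) + ε) := by
    intro a ha
    obtain ⟨h1, h2, h3, h4, h5, h6⟩ := hdb a ha
    have := norm_weyl_major_pow_le hY hC hYp hCY2 h1 h2 h5 h6 (hL _ _ h1 h4)
    rw [div_pow, div_le_iff₀ (by positivity)] at this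
    refine this.trans (le_of_eq ?_)
    ring
  have hw := sum_major_weights_le (q := p ^ 8) (κ := κ) (ε := ε) (by positivity) (by positivity)
    (fun a ha => (hdb a ha).1) (fun a ha => (hdb a ha).2.1) (fun a ha => (hdb a ha).2.2.1)
    (fun a ha => (hdb a ha).2.2.2.2.1) (fun a ha => (hdb a ha).2.2.2.2.2)
  have h1 : 2 ^ 49 * (16 * κ) ≤ 1 / 8 := by
    have : 2 ^ 49 * (16 * κ) = 2 ^ 52 * L ^ 5 / C ^ 16 * (1 / 8) := by
      rw [hκ]; field_simp; ring
    rw [this]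
    have : 2 ^ 52 * L ^ 5 / (C : ℝ) ^ 16 ≤ 1 := (div_le_one (by positivity)).mpr hLC
    linarith
  have h2 : 2 ^ 49 * (4 * ((Y ^ 8 : ℕ) : ℝ) ^ 3 * ε) ≤ 1 / 8 := by
    have hY1 : (1 : ℝ) ≤ Y := by exact_mod_cast hY
    have hz : (2 ^ 12 * (C : ℝ) ^ 7 / Y) ^ 2 ≤ 1 / (64 * Y) := by
      rw [div_pow, div_le_div_iff₀ (by positivity) (by positivity)]
      calc (2 ^ 12 * (C : ℝ) ^ 7) ^ 2 * (64 * (Y : ℝ)) = 2 ^ 30 * (C : ℝ) ^ 14 * (Y : ℝ) := by ring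
        _ ≤ (Y : ℝ) * (Y : ℝ) := by gcongr
        _ = _ := by ring
    calc _ = 2 ^ 51 * (Y : ℝ) ^ 24 * ((2 ^ 12 * (C : ℝ) ^ 7 / Y) ^ 2) ^ 25 := by
          rw [hε]; push_cast; ring
      _ ≤ 2 ^ 51 * (Y : ℝ) ^ 24 * (1 / (64 * Y)) ^ 25 := by gcongr
      _ = 1 / 2 ^ 99 / Y := by field_simp; norm_num
      _ ≤ 1 / 2 ^ 99 / 1 := by gcongr
      _ ≤ 1 / 8 := by norm_num
  calc _ ≤ ∑ a ∈ A, ((C * p : ℕ) : ℝ) ^ 50 * 2 ^ 49 * (κ *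
        (1 / ((d a : ℝ) ^ 3 * (((a : ℤ) * d a - b a * (p ^ 8 : ℕ)).natAbs : ℝ) ^ 2)) + ε) :=
        sum_le_sum hpt
    _ ≤ ((C * p : ℕ) : ℝ) ^ 50 * 2 ^ 49 * (16 * κ + 4 * ((Y ^ 8 : ℕ) : ℝ) ^ 3 * ε) := by
        rw [← mul_sum]; gcongr
    _ = ((C * p : ℕ) : ℝ) ^ 50 *
        (2 ^ 49 * (16 * κ) + 2 ^ 49 * (4 * ((Y ^ 8 : ℕ) : ℝ) ^ 3 * ε)) := by ring
    _ ≤ ((C * p : ℕ) : ℝ) ^ 50 * (1 / 8 + 1 / 8) := by gcongr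
    _ = _ := by ring

/-- Total contribution of the minor arcs for a sum over a thin set of frequencies. -/
theorem sum_minor_le {q : ℕ} (hq : 0 < q) {V A : Finset ℕ} (hV : ∀ v ∈ V, v < q)
    (hA : A ⊆ range q) {t : ℕ → ℝ} {B : ℝ} (hB : 0 ≤ B) (ht : ∀ a ∈ A, t a ≤ B) :
    ∑ a ∈ A, ‖∑ v ∈ V, expo ((a : ℝ) / q * v)‖ ^ 2 * t a ≤ q * #V * B := by
  have hP := sum_norm_sq_sum_expo hq V (fun v => (v : ℤ)) (fun _ => 1) (by
    intro x hx y hy h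
    have h1 := hV x hx
    have h2 := hV y hy
    have h3 := Int.eq_zero_of_abs_lt_dvd h (by rw [abs_lt]; omega)
    omega)
  simp only [one_mul, norm_one, one_pow, sum_const, nsmul_eq_mul, mul_one, Int.cast_natCast] at hP
  calc _ ≤ ∑ a ∈ A, ‖∑ v ∈ V, expo ((a : ℝ) / q * v)‖ ^ 2 * B :=
        sum_le_sum fun a ha => mul_le_mul_of_nonneg_left (ht a ha) (by positivity)
    _ ≤ ∑ a ∈ range q, ‖∑ v ∈ V, expo ((a : ℝ) / q * v)‖ ^ 2 * B :=
        sum_le_sum_of_subset_of_nonneg hA fun _ _ _ => by positivity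
    _ = (∑ a ∈ range q, ‖∑ v ∈ V, expo ((a : ℝ) * (v / q))‖ ^ 2) * B := by
        rw [sum_mul]
        refine sum_congr rfl fun a _ => ?_
        simp only [div_mul_eq_mul_div, mul_div_assoc]
    _ = _ := by rw [hP]

theorem norm_sum_expo_le_card {ι : Type*} (s : Finset ι) (f : ι → ℝ) :
    ‖∑ x ∈ s, expo (f x)‖ ≤ #s := by
  refine (norm_sum_le _ _).trans (le_of_eq ?_)
  simp

/-- The circle method modulo `p ^ 8`. -/
theorem sum_norm_generating_lt {p Y C N : ℕ} {L : ℝ} (hp : p.Prime) (hY : 2 ≤ Y) (hC : 0 < C)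
    (hYp : Y ^ 9 ≤ p) (hCY : 2 ^ 30 * C ^ 14 ≤ Y) (hLC : 2 ^ 52 * L ^ 5 ≤ C ^ 16)
    (hL : ∀ (d : ℕ) (b : ℤ), 0 < d → IsCoprime b d →
      (‖∑ x ∈ range d, expo (b * (x : ℝ) ^ 8 / d)‖ / d) ^ 10 * d ≤ L)
    {V U : Finset ℕ} (hV : ∀ v ∈ V, v < p ^ 8) (hU : ∀ u ∈ U, u < N)
    (hN : N * Y ^ 8 ≤ 2 ^ 9 * p ^ 8) (hV0 : 0 < #V) (hU0 : 0 < #U)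
    (hVU : 2 ^ 16 * (p ^ 8) ^ 3 ≤ Y ^ 9 * #V ^ 2 * #U) :
    ∑ a ∈ Ico 1 (p ^ 8), ‖∑ v ∈ V, expo ((a : ℝ) / (p ^ 8 : ℕ) * v)‖ ^ 2 *
      (‖∑ x ∈ Icc 1 Y, ∑ u ∈ U, expo ((a : ℝ) / (p ^ 8 : ℕ) * ((x : ℝ) ^ 8 * u))‖ *
        ‖∑ i ∈ range (C * p), expo ((a : ℝ) / (p ^ 8 : ℕ) * ((C * p + i : ℕ) : ℝ) ^ 8)‖ ^ 50) <
      #V ^ 2 * (Y * #U) * ((C * p : ℕ) : ℝ) ^ 50 := by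
  classical
  have hq : 0 < p ^ 8 := by have := hp.pos; positivity
  have hX' : (0 : ℝ) < ((C * p : ℕ) : ℝ) := by exact_mod_cast Nat.mul_pos hC hp.pos
  have hY' : (0 : ℝ) < Y := by exact_mod_cast (by omega : 0 < Y)
  have hV' : (0 : ℝ) < #V := by exact_mod_cast hV0
  have hU' : (0 : ℝ) < #U := by exact_mod_cast hU0
  have hVU' : (2 : ℝ) ^ 16 * ((p ^ 8 : ℕ) : ℝ) ^ 3 ≤ Y ^ 9 * #V ^ 2 * #U := by exact_mod_cast hVU
  set X : ℝ := ((C * p : ℕ) : ℝ) with hX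
  set v : ℕ → ℝ := fun a => ‖∑ v ∈ V, expo ((a : ℝ) / (p ^ 8 : ℕ) * v)‖ with hv
  set T : ℕ → ℝ := fun a =>
    ‖∑ x ∈ Icc 1 Y, ∑ u ∈ U, expo ((a : ℝ) / (p ^ 8 : ℕ) * ((x : ℝ) ^ 8 * u))‖ with hT
  set S : ℕ → ℝ := fun a =>
    ‖∑ i ∈ range (C * p), expo ((a : ℝ) / (p ^ 8 : ℕ) * ((C * p + i : ℕ) : ℝ) ^ 8)‖ with hS
  have hT0 : ∀ a, 0 ≤ T a := fun a => norm_nonneg _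
  have hS0 : ∀ a, 0 ≤ S a := fun a => norm_nonneg _
  have hv0 : ∀ a, 0 ≤ v a := fun a => norm_nonneg _
  have hvV : ∀ a, v a ≤ #V := fun a => norm_sum_expo_le_card V _
  have hSX : ∀ a, S a ≤ X := fun a => by
    have := norm_sum_expo_le_card (range (C * p))
      fun i => (a : ℝ) / (p ^ 8 : ℕ) * ((C * p + i : ℕ) : ℝ) ^ 8
    rwa [card_range] at this
  have hTY : ∀ a, T a ≤ Y * #U := fun a => by
    have := norm_sum_expo_le_card (Icc 1 Y ×ˢ U)
      fun z => (a : ℝ) / (p ^ 8 : ℕ) * ((z.1 : ℝ) ^ 8 * z.2)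
    rw [sum_product, card_product, Nat.card_Icc, Nat.add_sub_cancel, Nat.cast_mul] at this
    exact this
  change ∑ a ∈ Ico 1 (p ^ 8), v a ^ 2 * (T a * S a ^ 50) < _
  set P : ℕ → Prop := fun a => T a ^ 2 * (Y : ℝ) ^ 7 ≤ #U * (2 ^ 12 * p ^ 8) with hP
  rw [← sum_filter_add_sum_filter_not (Ico 1 (p ^ 8)) P]
  have hminor : ∑ a ∈ Ico 1 (p ^ 8) with P a, v a ^ 2 * (T a * S a ^ 50) ≤
      1 / 4 * (#V ^ 2 * (Y * #U) * X ^ 50) := by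
    have hTm : ∀ a ∈ (Ico 1 (p ^ 8)).filter P,
        T a * S a ^ 50 ≤ (Y * #U) * (#V / (4 * (p ^ 8 : ℕ))) * X ^ 50 := by
      intro a ha
      have hPa : T a ^ 2 * (Y : ℝ) ^ 7 ≤ #U * (2 ^ 12 * p ^ 8) := (mem_filter.mp ha).2
      have : T a ≤ (Y * #U) * (#V / (4 * (p ^ 8 : ℕ))) := by
        refine (abs_le_of_sq_le_sq' ?_ (by positivity)).2
        have hq' : (0 : ℝ) < ((p ^ 8 : ℕ) : ℝ) := by exact_mod_cast hq
        have e : ((p ^ 8 : ℕ) : ℝ) = (p : ℝ) ^ 8 := by push_cast; rfl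
        rw [← e] at hPa
        refine le_of_mul_le_mul_right ?_ (by positivity : 0 < (Y : ℝ) ^ 7)
        refine hPa.trans ?_
        have : ((Y * #U) * (#V / (4 * ((p ^ 8 : ℕ) : ℝ)))) ^ 2 * (Y : ℝ) ^ 7 =
            #U * (Y ^ 9 * #V ^ 2 * #U) / (16 * ((p ^ 8 : ℕ) : ℝ) ^ 2) := by
          field_simp
          norm_num
        rw [this, le_div_iff₀ (by positivity)]
        calc _ = (#U : ℝ) * (2 ^ 16 * ((p ^ 8 : ℕ) : ℝ) ^ 3) := by ring
          _ ≤ _ := by gcongr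
      gcongr
      exact hSX a
    refine (sum_minor_le hq hV ?_ (by positivity) hTm).trans (le_of_eq ?_)
    · intro a ha
      exact mem_range.mpr (mem_Ico.mp (mem_filter.mp ha).1).2
    · have hq' : (0 : ℝ) < ((p ^ 8 : ℕ) : ℝ) := by exact_mod_cast hq
      field_simp
  have hmajor : ∑ a ∈ Ico 1 (p ^ 8) with ¬ P a, v a ^ 2 * (T a * S a ^ 50) ≤
      1 / 4 * (#V ^ 2 * (Y * #U) * X ^ 50) := by
    have := sum_major_le hp (by omega) hC hYp hCY hLC hL
      (A := (Ico 1 (p ^ 8)).filter fun a => ¬ P a) (fun a ha => by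
        obtain ⟨h1, h2⟩ := mem_filter.mp ha
        rw [mem_Ico] at h1
        exact (minor_or_major hp hY hYp h1.1 h1.2 hU hN).resolve_left h2)
    calc _ ≤ ∑ a ∈ Ico 1 (p ^ 8) with ¬ P a, #V ^ 2 * ((Y * #U) * S a ^ 50) := by
          refine sum_le_sum fun a _ => ?_
          have := hS0 a
          have := hv0 a
          have := hvV a
          have := hTY a
          gcongr
      _ = (#V ^ 2 * (Y * #U)) * ∑ a ∈ Ico 1 (p ^ 8) with ¬ P a, S a ^ 50 := by
          rw [mul_sum]
          refine sum_congr rfl fun a _ => by ring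
      _ ≤ (#V ^ 2 * (Y * #U)) * (1 / 4 * X ^ 50) := by gcongr
      _ = _ := by ring
  have : (0 : ℝ) < #V ^ 2 * (Y * #U) * X ^ 50 := by positivity
  linarith

/-- Every residue class modulo `p ^ 8` contains a fairly small sum of `176` eighth powers. -/
theorem exists_isRepr_modEq {p Y C f : ℕ} {L : ℝ} (hp : p.Prime) (hC : 0 < C)
    (hYp : Y ^ 9 ≤ p) (hpY : p ≤ (2 * Y) ^ 9) (hCY : 2 ^ 30 * C ^ 14 ≤ Y) (hf : 9872 ≤ f)
    (hY : 2 ^ f ≤ Y) (hLC : 2 ^ 52 * L ^ 5 ≤ C ^ 16)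
    (hL : ∀ (d : ℕ) (b : ℤ), 0 < d → IsCoprime b d →
      (‖∑ x ∈ range d, expo (b * (x : ℝ) ^ 8 / d)‖ / d) ^ 10 * d ≤ L) (r : ℕ) :
    ∃ n, n ≡ r [MOD p ^ 8] ∧ n ≤ 2 ^ 14 * C ^ 8 * p ^ 8 ∧ IsRepr n 176 8 := by
  have hY2 : 4 ≤ Y := le_trans (by norm_num) ((Nat.pow_le_pow_right two_pos
    (by omega : 2 ≤ f)).trans hY)
  have hYp1 : Y ≤ p := (Nat.le_self_pow (by norm_num) Y).trans hYp
  have hM : p ≤ 8 * (p / 4) := by omega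
  have hM0 : 0 < p / 4 := by omega
  have hW0 : 0 < p / Y := Nat.div_pos hYp1 (by omega)
  have hW : p ≤ 2 * Y * (p / Y) := by
    have := Nat.lt_mul_div_succ p (by omega : 0 < Y)
    nlinarith
  have hMp : (p / 4) * 4 ≤ p := Nat.div_mul_le_self p 4
  have hWp : (p / Y) * Y ≤ p := Nat.div_mul_le_self p Y
  obtain ⟨V, a, hVr, hVlt, hVcard, ha⟩ := exists_dense_sums (k := 41) (by norm_num) hM0
  obtain ⟨U, b, hUr, hUlt, hUcard, hb⟩ := exists_dense_sums (k := 41) (by norm_num) hW0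
  obtain ⟨K, hK⟩ : ∃ K : ℕ, K = 2 ^ 574 := ⟨_, rfl⟩
  rw [← hK] at hVcard hUcard
  have hp0 := hp.pos
  have hq : 0 < p ^ 8 := Nat.pow_pos hp0
  have hM8 : (p / 4) ^ 8 * 2 ^ 16 ≤ p ^ 8 := by
    calc (p / 4) ^ 8 * 2 ^ 16 = ((p / 4) * 4) ^ 8 := by rw [mul_pow]; norm_num
      _ ≤ _ := Nat.pow_le_pow_left hMp 8
  have hW8 : (p / Y) ^ 8 * Y ^ 8 ≤ p ^ 8 := by
    rw [← mul_pow]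
    exact Nat.pow_le_pow_left hWp 8
  have hVq : ∀ v ∈ V, v < p ^ 8 := fun v hv => by
    have := hVlt v hv
    omega
  have hv : p ^ 8 ≤ 2 ^ 24 * (#V * a ^ 7 * K) := by
    calc p ^ 8 ≤ (8 * (p / 4)) ^ 8 := Nat.pow_le_pow_left hM 8
      _ = 2 ^ 24 * (p / 4) ^ 8 := by rw [mul_pow]; norm_num
      _ ≤ _ := Nat.mul_le_mul_left _ hVcard
  have hu : p ^ 8 ≤ 2 ^ 8 * Y ^ 8 * (#U * b ^ 7 * K) := by
    calc p ^ 8 ≤ (2 * Y * (p / Y)) ^ 8 := Nat.pow_le_pow_left hW 8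
      _ = 2 ^ 8 * Y ^ 8 * (p / Y) ^ 8 := by rw [mul_pow, mul_pow]
      _ ≤ _ := Nat.mul_le_mul_left _ hUcard
  have ha' : a ^ 8 ^ 41 ≤ p ^ 7 ^ 41 := ha.trans (Nat.pow_le_pow_left (by omega) _)
  have hb' : b ^ 8 ^ 41 ≤ p ^ 7 ^ 41 := hb.trans (Nat.pow_le_pow_left (Nat.div_le_self p Y) _)
  have hVU := minor_density_le hK hf hY hpY ha' hb' hv hu
  have hV0 : 0 < #V := by
    rcases Nat.eq_zero_or_pos #V with h | h
    · rw [h, zero_mul, zero_mul, mul_zero] at hv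
      omega
    · exact h
  have hU0 : 0 < #U := by
    rcases Nat.eq_zero_or_pos #U with h | h
    · rw [h, zero_mul, zero_mul, mul_zero] at hu
      omega
    · exact h
  have hlt := sum_norm_generating_lt (N := 2 ^ 9 * (p / Y) ^ 8) hp (by omega) hC hYp hCY hLC hL
    hVq hUlt (by rw [mul_assoc]; exact Nat.mul_le_mul_left _ hW8) hV0 hU0 hVU
  obtain ⟨z, hz, hzr⟩ := exists_modEq_of_sum_norm_lt hq
    ((V ×ˢ V) ×ˢ (Icc 1 Y ×ˢ U) ×ˢ Fintype.piFinset fun _ : Fin 50 => range (C * p))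
    (fun z => z.1.1 + z.1.2 + z.2.1.1 ^ 8 * z.2.1.2 + ∑ i, (C * p + z.2.2 i) ^ 8) (by
      refine lt_of_le_of_lt (le_of_eq (sum_congr rfl fun a _ => ?_)) (lt_of_lt_of_eq hlt ?_)
      · simp only [← mul_div_assoc, mul_div_right_comm]
        rw [sum_expo_factor, norm_mul, norm_mul, norm_pow, norm_pow, mul_assoc]
      · rw [card_product, card_product, card_product, card_product, Nat.card_Icc,
          Nat.add_sub_cancel, Fintype.card_piFinset_const, card_range]
        push_cast
        ring) r
  simp only [mem_product, mem_Icc, Fintype.mem_piFinset, mem_range] at hz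
  obtain ⟨⟨h1, h2⟩, ⟨h3, h4⟩, h5⟩ := hz
  refine ⟨_, hzr, ?_, ?_⟩
  · have hC8 : 1 ≤ C ^ 8 := Nat.one_le_pow _ _ hC
    have hx : z.2.1.1 ^ 8 * z.2.1.2 ≤ 2 ^ 9 * p ^ 8 := by
      calc _ ≤ Y ^ 8 * (2 ^ 9 * (p / Y) ^ 8) :=
            Nat.mul_le_mul (Nat.pow_le_pow_left h3.2 8) (hUlt _ h4).le
        _ = 2 ^ 9 * ((p / Y) ^ 8 * Y ^ 8) := by ring
        _ ≤ _ := Nat.mul_le_mul_left _ hW8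
    have hs : ∑ i, (C * p + z.2.2 i) ^ 8 ≤ 50 * (2 ^ 8 * (C ^ 8 * p ^ 8)) := by
      calc _ ≤ ∑ _i : Fin 50, 2 ^ 8 * (C ^ 8 * p ^ 8) := by
            refine sum_le_sum fun i _ => ?_
            rw [← mul_pow, ← mul_pow]
            exact Nat.pow_le_pow_left (by have := h5 i; omega) 8
        _ = _ := by simp
    have h6 := hVlt _ h1
    have h7 := hVlt _ h2
    have h8 : p ^ 8 ≤ C ^ 8 * p ^ 8 := Nat.le_mul_of_pos_left _ hC8
    rw [mul_assoc]
    omega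
  · exact (((hVr _ h1).add (hVr _ h2)).add ((hUr _ h4).pow_mul h3.1)).add
      (isRepr_sum_pow (a := fun i => C * p + z.2.2 i) fun i =>
        Nat.add_pos_left (Nat.mul_pos hC hp0) _)

/-- For every `m` with `a ≤ m ≤ b`, the number `m + s` is a sum of `s` positive eighth powers. -/
def Covers (s a b : ℕ) : Prop :=
  ∀ m, a ≤ m → m ≤ b → IsRepr (m + s) s 8

theorem Covers.mono {s t a b c : ℕ} (h : Covers s a b) (hst : s ≤ t) (hcb : c ≤ b) :
    Covers t a c := fun m ham hmc => by
  obtain ⟨k, rfl⟩ := Nat.exists_eq_add_of_le hst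
  simpa [add_assoc] using (h m ham (hmc.trans hcb)).add (isRepr_self k)

theorem two_mul_succ_pow_eight_le (w : ℕ) : 2 * (w + 1) ^ 8 ≤ (w + 2) ^ 8 + w ^ 8 := by
  have : (w + 2) ^ 8 + w ^ 8 = 2 * (w + 1) ^ 8
      + 2 * (28 * (w + 1) ^ 6 + 70 * (w + 1) ^ 4 + 28 * (w + 1) ^ 2 + 1) := by ring
  omega

theorem Covers.step {s a b : ℕ} (h : Covers s a b) (w : ℕ)
    (hw : (w + 1) ^ 8 + a ≤ b + 1 + w ^ 8) : Covers (s + 1) a (b + (w + 1) ^ 8 - 1) := by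
  intro m ham hmb
  induction w with
  | zero => exact h.mono (Nat.le_succ s) le_rfl m ham (by simpa using hmb)
  | succ w ih =>
    have := two_mul_succ_pow_eight_le w
    have hpos : 1 ≤ (w + 1) ^ 8 := Nat.one_le_pow _ _ w.succ_pos
    rcases Nat.lt_or_ge (b + (w + 1) ^ 8 - 1) m with hm | hm
    · have h1 := (h (m + 1 - (w + 1 + 1) ^ 8) (by omega) (by omega)).add
        (isRepr_pow (w + 1).succ_pos)
      rwa [show m + 1 - (w + 1 + 1) ^ 8 + s + (w + 1).succ ^ 8 = m + (s + 1) by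
        rw [Nat.succ_eq_add_one]; omega] at h1
    · exact ih (by rw [show w + 1 + 1 = w + 2 from rfl] at hw; omega) hm

theorem Covers.step_real {s a b : ℕ} {z : ℝ} (h : Covers s a b) (ha : a ≤ 10 ^ 8) (hz : 2 ≤ z)
    (hb : 2 ^ 36 * z ^ 7 ≤ b) : ∃ c : ℕ, 2 ^ 36 * z ^ 8 ≤ c ∧ Covers (s + 1) a c := by
  obtain ⟨w, hw⟩ : ∃ w, ⌊24 * z⌋₊ = w + 1 :=
    Nat.exists_eq_succ_of_ne_zero (Nat.floor_pos.mpr (by linarith)).ne'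
  have hle : ((w : ℝ) + 1) ≤ 24 * z := by
    have := Nat.floor_le (by linarith : 0 ≤ 24 * z)
    rw [hw] at this
    exact_mod_cast this
  have hge : 47 / 2 * z ≤ (w : ℝ) + 1 := by
    have := Nat.lt_floor_add_one (24 * z)
    rw [hw] at this
    push_cast at this
    linarith
  have hw0 : (0 : ℝ) ≤ w := w.cast_nonneg
  have hz7 : (2 : ℝ) ^ 7 ≤ z ^ 7 := by gcongr
  have hpow : ((w : ℝ) + 1) ^ 7 ≤ (24 * z) ^ 7 := by gcongr
  have hgap : ((w : ℝ) + 1) ^ 8 ≤ w ^ 8 + 8 * (w + 1) ^ 7 := by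
    have : (w : ℝ) ^ 8 + 8 * (w + 1) ^ 7 = (w + 1) ^ 8 + (28 * w ^ 6 + 112 * w ^ 5 + 210 * w ^ 4
      + 224 * w ^ 3 + 140 * w ^ 2 + 48 * w + 7) := by ring
    rw [this]
    have : (0 : ℝ) ≤ 28 * w ^ 6 + 112 * w ^ 5 + 210 * w ^ 4
      + 224 * w ^ 3 + 140 * w ^ 2 + 48 * w + 7 := by positivity
    linarith
  have haR : (a : ℝ) ≤ 10 ^ 8 := by exact_mod_cast ha
  refine ⟨b + (w + 1) ^ 8 - 1, ?_, h.step w ?_⟩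
  · have h8 : (47 / 2 * z) ^ 8 ≤ ((w : ℝ) + 1) ^ 8 := by gcongr
    have hz8 : 0 ≤ z ^ 8 := by positivity
    have hb1 : (1 : ℝ) ≤ b := by linarith
    rw [Nat.cast_sub (le_add_left (Nat.one_le_pow _ _ w.succ_pos))]
    push_cast
    rw [mul_pow] at h8
    linarith
  · rw [mul_pow] at hpow
    have : ((w : ℝ) + 1) ^ 8 + a ≤ b + 1 + w ^ 8 := by linarith
    exact_mod_cast this

theorem Covers.iterate {s a b : ℕ} (h : Covers s a b) (ha : a ≤ 10 ^ 8) (hb : 2 ^ 43 ≤ b)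
    (u : ℕ) : ∃ c : ℕ, (2 : ℝ) ^ 36 * ((2 : ℝ) ^ ((8 / 7 : ℝ) ^ u)) ^ 7 ≤ c ∧
      Covers (s + u) a c := by
  induction u with
  | zero =>
    refine ⟨b, ?_, h⟩
    have : ((2 ^ 43 : ℕ) : ℝ) ≤ b := by exact_mod_cast hb
    norm_num at this ⊢
    exact this
  | succ u ih =>
    obtain ⟨c, hc, hcov⟩ := ih
    obtain ⟨d, hd, hcov⟩ := hcov.step_real ha
      (Real.self_le_rpow_of_one_le one_le_two (one_le_pow₀ (by norm_num))) hc
    refine ⟨d, le_trans (le_of_eq ?_) hd, hcov⟩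
    rw [← Real.rpow_natCast _ 7, ← Real.rpow_mul zero_le_two, ← Real.rpow_natCast _ 8,
      ← Real.rpow_mul zero_le_two, pow_succ]
    congr 2
    push_cast
    ring

theorem Covers.two_pow {s a b : ℕ} (h : Covers s a b) (ha : a ≤ 10 ^ 8) (hb : 2 ^ 43 ≤ b)
    {u K : ℕ} (hK : K * 7 ^ u ≤ 36 * 7 ^ u + 7 * 8 ^ u) : Covers (s + u) a (2 ^ K) := by
  obtain ⟨c, hc, hcov⟩ := h.iterate ha hb u
  refine hcov.mono le_rfl ?_
  have hK' : (K : ℝ) ≤ 36 + 7 * (8 / 7 : ℝ) ^ u := by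
    have : ((K * 7 ^ u : ℕ) : ℝ) ≤ (36 * 7 ^ u + 7 * 8 ^ u : ℕ) := by exact_mod_cast hK
    push_cast at this
    rw [div_pow, ← sub_nonneg]
    have h7 : (0 : ℝ) < 7 ^ u := by positivity
    rw [show (36 : ℝ) + 7 * (8 ^ u / 7 ^ u) - K = (36 * 7 ^ u + 7 * 8 ^ u - K * 7 ^ u) / 7 ^ u by
      field_simp]
    exact div_nonneg (by linarith) h7.le
  have : ((2 ^ K : ℕ) : ℝ) ≤ c := by
    refine le_trans ?_ hc
    rw [← Real.rpow_natCast _ 7, ← Real.rpow_mul zero_le_two, ← Real.rpow_natCast 2 36,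
      ← Real.rpow_add zero_lt_two, Nat.cast_pow, Nat.cast_ofNat, ← Real.rpow_natCast]
    refine Real.rpow_le_rpow_of_exponent_le one_le_two ?_
    push_cast
    linarith
  exact_mod_cast this

/-- `Nat` case distinction on `n`; the kernel evaluates `n` to a literal before passing it on. -/
def force {α : Type} (n : ℕ) (f : ℕ → α) : α :=
  Nat.casesOn n (f 0) fun m => f (m + 1)

theorem force_eq {α : Type} (n : ℕ) (f : ℕ → α) : force n f = f n := by
  cases n <;> rfl

/-- If the bits of `R` encode a set `S`, the bits of `widen k R t` encode the union of `S` and its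
translates by `k * (a ^ 8 - 1)` for `2 ≤ a ≤ t + 1`. -/
def widen (k R : ℕ) : ℕ → ℕ
  | 0 => R
  | t + 1 => widen k R t ||| R <<< (k * ((t + 2) ^ 8 - 1))

/-- Successive applications of `widen` to the set encoded by `R`, truncated by the bit mask `M`. -/
def sieve (M : ℕ) : List (ℕ × ℕ) → ℕ → ℕ
  | [], R => R
  | p :: l, R => force (widen p.1 R p.2 &&& M) (sieve M l)

theorem testBit_widen {k R t m : ℕ} :
    (widen k R t).testBit m = true ↔ R.testBit m = true ∨
      ∃ a, 2 ≤ a ∧ a ≤ t + 1 ∧ k * (a ^ 8 - 1) ≤ m ∧ R.testBit (m - k * (a ^ 8 - 1)) = true := by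
  induction t with
  | zero =>
    simp only [widen]
    exact ⟨Or.inl, fun h => h.elim id fun ⟨a, h1, h2, _⟩ => by omega⟩
  | succ t ih =>
    simp only [widen, Nat.testBit_or, Bool.or_eq_true, ih, Nat.testBit_shiftLeft,
      Bool.and_eq_true, decide_eq_true_eq, ge_iff_le]
    constructor
    · rintro ((h | ⟨a, h1, h2, h3⟩) | ⟨h1, h2⟩)
      · exact Or.inl h
      · exact Or.inr ⟨a, h1, by omega, h3⟩
      · exact Or.inr ⟨t + 2, by omega, le_rfl, h1, h2⟩
    · rintro (h | ⟨a, h1, h2, h3⟩)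
      · exact Or.inl (Or.inl h)
      · rcases Nat.lt_or_ge a (t + 2) with h | h
        · exact Or.inl (Or.inr ⟨a, h1, by omega, h3⟩)
        · obtain rfl : a = t + 2 := by omega
          exact Or.inr h3

theorem isRepr_of_testBit_sieve {M : ℕ} (l : List (ℕ × ℕ)) {R s : ℕ}
    (hR : ∀ m, R.testBit m = true → IsRepr (m + s) s 8) {m : ℕ}
    (hm : (sieve M l R).testBit m = true) :
    IsRepr (m + (s + (l.map Prod.fst).sum)) (s + (l.map Prod.fst).sum) 8 := by
  induction l generalizing R s with
  | nil => simpa using hR m hm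
  | cons p l ih =>
    rw [sieve, force_eq] at hm
    have := ih (s := s + p.1) (fun m' h => ?_) hm
    · simpa [add_assoc] using this
    · rw [Nat.testBit_and, Bool.and_eq_true, testBit_widen] at h
      rcases h.1 with h | ⟨a, h1, h2, h3, h4⟩
      · simpa [add_assoc] using (hR _ h).add (isRepr_self p.1)
      · have := (hR _ h4).add ((isRepr_self p.1).pow_mul (c := a) (by omega))
        have ha : 1 ≤ a ^ 8 := Nat.one_le_pow _ _ (by omega)
        rwa [show m' - p.1 * (a ^ 8 - 1) + s + a ^ 8 * p.1 = m' + (s + p.1) by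
          obtain ⟨c, hc⟩ := Nat.exists_eq_add_of_le ha
          obtain ⟨d, rfl⟩ := Nat.exists_eq_add_of_le h3
          rw [hc, Nat.add_sub_cancel_left, Nat.add_sub_cancel_left]
          ring] at this

theorem isRepr_of_testBit_sieve_one {M : ℕ} (l : List (ℕ × ℕ)) {m : ℕ}
    (hm : (sieve M l 1).testBit m = true) :
    IsRepr (m + (l.map Prod.fst).sum) (l.map Prod.fst).sum 8 := by
  have := isRepr_of_testBit_sieve l (R := 1) (s := 0) (fun m h => ?_) hm
  · simpa using this
  · rw [Nat.testBit_one_eq_true_iff_self_eq_zero] at h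
    subst h
    exact isRepr_zero

/-- Steps for sums of `334` eighth powers, applied below `2 ^ 22`. -/
def smallSteps : List (ℕ × ℕ) :=
  [(1, 5), (1, 5), (1, 5), (2, 5), (2, 5), (3, 4), (4, 4), (6, 4), (9, 4), (12, 3), (15, 3), (19, 3), (23, 3), (37, 3), (38, 3), (43, 3), (48, 3), (70, 2)]

/-- Steps for sums of `222` eighth powers, applied below `2 ^ 23`. -/
def mediumSteps : List (ℕ × ℕ) :=
  [(1, 6), (1, 6), (2, 5), (3, 5), (4, 5), (6, 4), (8, 4), (9, 4), (12, 4), (15, 4), (16, 4), (17, 4), (24, 3), (43, 3), (61, 3)]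

/-- Steps for sums of `84` eighth powers, applied below `2 ^ 26`. -/
def largeSteps : List (ℕ × ℕ) :=
  [(1, 7), (1, 7), (1, 7), (2, 6), (2, 6), (2, 6), (3, 5), (4, 5), (5, 5), (6, 5), (6, 5), (7, 5), (8, 5), (9, 5), (11, 4), (16, 4)]

theorem widen_sieve_smallSteps :
    (force (2 ^ (2 ^ 22) - 1) fun M => force (sieve M smallSteps 1) fun U =>
      Nat.beq (widen 1 U 5 &&& M) U && Nat.beq (1 &&& U) 1) = true := by
  decide +kernel

theorem sieve_mediumSteps :
    (force (2 ^ (2 ^ 23) - 1) fun M => force (sieve M mediumSteps 1) fun U =>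
      Nat.beq (U ||| (2 ^ (2 ^ 22) - 1)) M) = true := by
  decide +kernel

theorem sieve_largeSteps :
    (force ((2 ^ (2 ^ 24)) ^ 4 - 1) fun M => force (sieve M largeSteps 1) fun U =>
      Nat.beq (U ||| ((2 ^ 13421773) ^ 4 - 1)) M) = true := by
  decide +kernel

theorem testBit_of_or_eq {U A N m : ℕ} (h : U ||| (2 ^ A - 1) = 2 ^ N - 1) (hA : A ≤ m)
    (hN : m < N) : U.testBit m = true := by
  have := congrArg (fun x => x.testBit m) h
  simpa [Nat.testBit_two_pow_sub_one, hN, Nat.not_lt.mpr hA] using this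

theorem covers_of_sieve {M T A N : ℕ} (l : List (ℕ × ℕ)) (hM : M = 2 ^ N - 1)
    (hT : T = 2 ^ A - 1)
    (h : (force M fun M => force (sieve M l 1) fun U => Nat.beq (U ||| T) M) = true) :
    Covers (l.map Prod.fst).sum A (N - 1) := fun m hA hN => by
  rw [force_eq, force_eq] at h
  have h := Nat.eq_of_beq_eq_true h
  rcases Nat.eq_zero_or_pos m with rfl | hm
  · simpa using isRepr_self _
  · exact isRepr_of_testBit_sieve_one l (testBit_of_or_eq (hM ▸ hT ▸ h) hA (by omega))

theorem covers_mediumSteps : Covers 222 (2 ^ 22) (2 ^ 23 - 1) :=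
  covers_of_sieve mediumSteps rfl rfl sieve_mediumSteps

theorem covers_largeSteps : Covers 84 (13421773 * 4) (2 ^ 24 * 4 - 1) :=
  covers_of_sieve largeSteps
    (by rw [pow_mul]) (by rw [pow_mul]) sieve_largeSteps

theorem le_of_isRepr {n j : ℕ} (h : IsRepr n j 8) : j ≤ n := by
  obtain ⟨a, ha, rfl⟩ := h
  calc j = ∑ _i : Fin j, 1 := by simp
    _ ≤ ∑ i, a i ^ 8 := Finset.sum_le_sum fun i _ => Nat.one_le_pow _ _ (ha i)

theorem testBit_of_isRepr {N U t : ℕ} (h0 : U.testBit 0 = true)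
    (hU : widen 1 U t &&& (2 ^ N - 1) = U) (ht : N ≤ (t + 2) ^ 8 - 1) {j m : ℕ} (hm : m < N)
    (h : IsRepr (m + j) j 8) : U.testBit m = true := by
  induction j generalizing m with
  | zero =>
    obtain ⟨a, -, ha⟩ := h
    obtain rfl : m = 0 := by simpa using ha.symm
    exact h0
  | succ j ih =>
    obtain ⟨x, hx, hxm, hr⟩ := isRepr_succ_iff.mp h
    have hj := le_of_isRepr hr
    have hx8 : 1 ≤ x ^ 8 := Nat.one_le_pow _ _ hx
    have hbit := ih (m := m - (x ^ 8 - 1)) (by omega)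
      (by rwa [show m - (x ^ 8 - 1) + j = m + (j + 1) - x ^ 8 by omega])
    have hxt : x ≤ t + 1 := by
      by_contra! hxt
      have : (t + 2) ^ 8 ≤ x ^ 8 := Nat.pow_le_pow_left hxt 8
      omega
    rw [← hU, Nat.testBit_and, Nat.testBit_two_pow_sub_one, Bool.and_eq_true, testBit_widen]
    refine ⟨?_, by simpa using hm⟩
    rcases Nat.lt_or_ge x 2 with hx2 | hx2
    · obtain rfl : x = 1 := by omega
      exact Or.inl (by simpa using hbit)
    · exact Or.inr ⟨x, hx2, hxt, by omega, by simpa using hbit⟩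

theorem isRepr_of_lt {j m : ℕ} (hm : m < 2 ^ 22) (h : IsRepr (m + j) j 8) :
    IsRepr (m + 334) 334 8 := by
  have hb := widen_sieve_smallSteps
  rw [force_eq, force_eq, Bool.and_eq_true] at hb
  obtain ⟨hU, h0⟩ := hb
  have h0' := congrArg (fun x => x.testBit 0) (Nat.eq_of_beq_eq_true h0)
  refine isRepr_of_testBit_sieve_one smallSteps
    (testBit_of_isRepr (N := 2 ^ 22) ?_ (Nat.eq_of_beq_eq_true hU) ?_ hm h)
  · simpa using h0'
  · norm_num

theorem exists_le_and_lt_succ {f : ℕ → ℕ} {n : ℕ} (h0 : f 0 ≤ n) (hn : ∃ t, n < f t) :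
    ∃ t, f t ≤ n ∧ n < f (t + 1) := by
  classical
  obtain ⟨t, ht⟩ : ∃ t, Nat.find hn = t + 1 :=
    Nat.exists_eq_succ_of_ne_zero fun h => absurd (Nat.find_spec hn) (by rw [h]; omega)
  exact ⟨t, not_lt.mp (Nat.find_min hn (by omega)), ht ▸ Nat.find_spec hn⟩

theorem isRepr_of_covers {i s a g K n : ℕ}
    (hrep : ∀ p, p.Prime → 2 ^ g ≤ p → ∀ r, ∃ k, k ≡ r [MOD p ^ 8] ∧ k ≤ 2 ^ K * p ^ 8 ∧
      IsRepr k i 8)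
    (hcov : Covers s a (2 ^ (K + 9))) (ha : a + s ≤ 2 ^ K)
    (hn : 2 ^ (K + 1 + 8 * (g + 1)) ≤ n) : IsRepr n (i + s) 8 := by
  obtain ⟨t, ht, ht'⟩ := exists_le_and_lt_succ (f := fun t => 2 ^ (K + 1) * (2 * (t + 2 ^ g)) ^ 8)
    (n := n) (by
      refine le_of_eq_of_le ?_ hn
      rw [pow_add _ (K + 1), zero_add, ← pow_succ', mul_comm 8, pow_mul]) ⟨n, by
      have h1 : 1 ≤ 2 ^ (K + 1) := Nat.one_le_two_pow
      have h2 : 1 ≤ 2 ^ g := Nat.one_le_two_pow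
      have h3 : 2 * (n + 2 ^ g) ≤ (2 * (n + 2 ^ g)) ^ 8 := Nat.le_self_pow (by norm_num) _
      have h4 : (2 * (n + 2 ^ g)) ^ 8 ≤ 2 ^ (K + 1) * (2 * (n + 2 ^ g)) ^ 8 :=
        Nat.le_mul_of_pos_left _ (by omega)
      omega⟩
  have hg : 0 < 2 ^ g := Nat.two_pow_pos g
  obtain ⟨p, hp, htp, hpt⟩ := Nat.exists_prime_lt_and_le_two_mul (t + 2 ^ g) (by omega)
  have hlow : 2 ^ (K + 1) * p ^ 8 ≤ n :=
    (Nat.mul_le_mul_left _ (Nat.pow_le_pow_left hpt 8)).trans ht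
  have hhigh : n < 2 ^ (K + 9) * p ^ 8 := by
    refine ht'.trans_le ?_
    rw [show 2 ^ (K + 9) * p ^ 8 = 2 ^ (K + 1) * (2 * p) ^ 8 by rw [mul_pow, pow_add, pow_add]; ring]
    exact Nat.mul_le_mul_left _ (Nat.pow_le_pow_left (by omega) 8)
  obtain ⟨k, hkn, hk, hrk⟩ := hrep p hp (by omega) n
  have hq : 0 < p ^ 8 := pow_pos hp.pos 8
  have hkle : k ≤ n := hk.trans (le_trans (Nat.mul_le_mul_right _
    (Nat.pow_le_pow_right two_pos (Nat.le_succ K))) hlow)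
  obtain ⟨m, hm⟩ := (Nat.modEq_iff_dvd' hkle).mp hkn
  have hmn : n = k + p ^ 8 * m := by omega
  have hm1 : 2 ^ K ≤ m := by
    refine Nat.le_of_mul_le_mul_left ?_ hq
    rw [pow_succ] at hlow
    nlinarith
  have hm2 : m < 2 ^ (K + 9) := by
    refine Nat.lt_of_mul_lt_mul_left (a := p ^ 8) ?_
    rw [mul_comm _ (2 ^ _)]
    omega
  have hms := hcov (m - s) (by omega) (by omega)
  rw [Nat.sub_add_cancel (by omega)] at hms
  rw [hmn]
  exact hrk.add (hms.pow_mul hp.pos)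

theorem Covers.extend {s a b : ℕ} (h : Covers s a b) (hab : a + 12000000 ≤ b) :
    Covers (s + 12) a (2 ^ 43) :=
  ((((((((((((h.step 7 (by omega)).step 8 (by omega)).step 9 (by omega)).step 10
    (by omega)).step 12 (by omega)).step 14 (by omega)).step 16 (by omega)).step 19
    (by omega)).step 23 (by omega)).step 28 (by omega)).step 35 (by omega)).step 45
    (by omega)).mono le_rfl (by omega)

theorem covers_below : Covers 334 (2 ^ 22) (2 ^ 2745383) := by
  have h := ((covers_mediumSteps.step 6 (by norm_num)).step 6 (by norm_num)).extend (by norm_num)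
  refine Covers.mono (h.two_pow (u := 97) (K := 2745383) ?_ ?_ ?_) ?_ le_rfl <;> norm_num

theorem covers_window : Covers 158 (13421773 * 4) (2 ^ 21623) := by
  have h := covers_largeSteps.extend (by norm_num)
  refine Covers.mono (h.two_pow (u := 61) (K := 21623) ?_ ?_ ?_) ?_ le_rfl <;> norm_num

theorem exists_isRepr_modEq_two_pow {p : ℕ} (hp : p.Prime) (hpg : 2 ^ 340470 ≤ p) (r : ℕ) :
    ∃ k, k ≡ r [MOD p ^ 8] ∧ k ≤ 2 ^ 21614 * p ^ 8 ∧ IsRepr k 176 8 := by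
  obtain ⟨c, hc⟩ : ∃ c, c = 2700 := ⟨_, rfl⟩
  obtain ⟨f, hf⟩ : ∃ f, f = 37830 := ⟨_, rfl⟩
  obtain ⟨l, hl⟩ : ∃ l, l = 8600 := ⟨_, rfl⟩
  obtain ⟨Y, hYp, hpY⟩ := exists_le_and_lt_succ (f := fun y => y ^ 9) (n := p) (by simp)
    ⟨p + 1, (Nat.lt_succ_self p).trans_le (Nat.le_self_pow (by norm_num) _)⟩
  have hfY : 2 ^ f ≤ Y := by
    have : (2 ^ f) ^ 9 < (Y + 1) ^ 9 := by
      rw [← pow_mul, show f * 9 = 340470 by omega]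
      exact hpg.trans_lt hpY
    have := lt_of_pow_lt_pow_left₀ 9 (Nat.zero_le _) this
    omega
  have hY : 1 ≤ Y := Nat.one_le_two_pow.trans hfY
  have h := exists_isRepr_modEq (C := 2 ^ c) (L := 2 ^ l) (Y := Y) (f := f) hp (by positivity) hYp
    (hpY.le.trans (Nat.pow_le_pow_left (by omega) 9)) ?_ (by omega) hfY ?_ ?_ r
  · rwa [← pow_mul, ← pow_add, show 14 + c * 8 = 21614 by omega] at h
  · rw [← pow_mul, ← pow_add, show 30 + c * 14 = f by omega]
    exact hfY
  · push_cast
    rw [← pow_mul, ← pow_mul, ← pow_add]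
    exact pow_le_pow_right₀ one_le_two (by omega)
  · intro d b hd hb
    rw [hl]
    exact norm_sum_expo_complete_pow_le hd hb

theorem isRepr_add_of_le {m : ℕ} (hm : 2 ^ 22 ≤ m) : IsRepr (m + 334) 334 8 := by
  rcases le_total m (2 ^ 2745383) with h | h
  · exact covers_below m hm h
  · exact isRepr_of_covers (i := 176) (s := 158) (g := 340470) (K := 21614)
      (fun p hp hpg r => exists_isRepr_modEq_two_pow hp hpg r) covers_window
      ((show 13421773 * 4 + 158 ≤ 2 ^ 26 by norm_num).trans
        (Nat.pow_le_pow_right two_pos (by norm_num))) (h.trans (Nat.le_add_right _ _))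

end EighthPowers

/-- for every `j ≥ 334` and every positive integer `m`, `m + j` is the
sum of exactly `j` positive eighth powers iff `m + 334` is the sum of exactly `334`
positive eighth powers. -/
theorem stmt_19 :
    ∀ j : ℕ, 334 ≤ j → ∀ m : ℕ, 0 < m →
      (IsRepr (m + j) j 8 ↔ IsRepr (m + 334) 334 8) := by
  intro j hj m _
  constructor
  · intro h
    rcases Nat.lt_or_ge m (2 ^ 22) with hm | hm
    · exact EighthPowers.isRepr_of_lt hm h
    · exact EighthPowers.isRepr_add_of_le hm
  · intro h
    obtain ⟨i, rfl⟩ := Nat.exists_eq_add_of_le hj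
    simpa [add_assoc] using h.add (EighthPowers.isRepr_self i)
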